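/- arXiv:math/0405274 — 2 statements merged into one kernel-verified Lean document; each statement's English description precedes it below -/
import Mathlib

section
/- Let A and B be finitely generated groups and F a common finite proper subgroup. Unless F is of index 2 in both A and B, the free product A*B and the amalgamated free product A*_F B are quasi-isometric. -/
/-- Word distance on a group w.r.t. a generating set `S`. -/
noncomputable def wordDist {G : Type*} [Group G] (S : Set G) (g h : G) : ℕ :=
  sInf {n | ∃ l : List G, l.length = n ∧ (∀ x ∈ l, x ∈ S ∨ x⁻¹ ∈ S) ∧ l.prod = g⁻¹ * h}

/-- `f` is a `(K, C)`-quasi-isometric embedding between the "metric spaces"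
given by the distance functions `dX` and `dY`. -/
def IsQIEmbedding (K C : ℝ) {X Y : Type*} (dX : X → X → ℝ) (dY : Y → Y → ℝ)
    (f : X → Y) : Prop :=
  ∀ a b : X, (1 / K) * dX a b - C ≤ dY (f a) (f b) ∧ dY (f a) (f b) ≤ K * dX a b + C

/-- `f` is a `(K, C)`-quasi-isometry between the "metric spaces" given by the
distance functions `dX` and `dY`: a quasi-isometric embedding with `C`-coarsely
dense image. -/
def IsQuasiIsometry (K C : ℝ) {X Y : Type*} (dX : X → X → ℝ) (dY : Y → Y → ℝ)
    (f : X → Y) : Prop :=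
  IsQIEmbedding K C dX dY f ∧ ∀ y : Y, ∃ a : X, dY (f a) y ≤ C

/-- Two groups are quasi-isometric if they have finite generating sets for which
the word metrics admit a quasi-isometry between them (this is independent of the
choice of finite generating sets). -/
def QuasiIsometricGroups (G H : Type*) [Group G] [Group H] : Prop :=
  ∃ (S : Finset G) (T : Finset H), Subgroup.closure (S : Set G) = ⊤ ∧
    Subgroup.closure (T : Set H) = ⊤ ∧
    ∃ (K C : ℝ) (f : G → H), 0 < K ∧ 0 ≤ C ∧
      IsQuasiIsometry K C (fun a b => (wordDist (S : Set G) a b : ℝ))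
        (fun a b => (wordDist (T : Set H) a b : ℝ)) f

/-- The amalgamated free product `A *_F B` of `A` and `B` along injections
`i : F →* A`, `j : F →* B`: the quotient of the free product `A ∗ B` by the
relations identifying the two copies of `F`. -/
def AmalgamatedFreeProduct (A B F : Type*) [Group A] [Group B] [Group F]
    (i : F →* A) (j : F →* B) : Type _ :=
  Monoid.Coprod A B ⧸ Subgroup.normalClosure
    {x | ∃ k : F, x = Monoid.Coprod.inl (i k) * (Monoid.Coprod.inr (j k))⁻¹}

instance (A B F : Type*) [Group A] [Group B] [Group F] (i : F →* A) (j : F →* B) :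
    Group (AmalgamatedFreeProduct A B F i j) :=
  inferInstanceAs (Group (Monoid.Coprod A B ⧸ Subgroup.normalClosure
    {x | ∃ k : F, x = Monoid.Coprod.inl (i k) * (Monoid.Coprod.inr (j k))⁻¹}))

/-! ### Weighted lists -/

/-- Two natural numbers agree up to a multiplicative constant. -/
def Comparable (K a b : ℕ) : Prop := a ≤ K * b ∧ b ≤ K * a

namespace Comparable

variable {K K' a b c a' b' : ℕ}

theorem mono (hK : K ≤ K') (h : Comparable K a b) : Comparable K' a b :=
  ⟨h.1.trans (Nat.mul_le_mul_right _ hK), h.2.trans (Nat.mul_le_mul_right _ hK)⟩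

theorem add (h : Comparable K a b) (h' : Comparable K a' b') :
    Comparable K (a + a') (b + b') := by
  refine ⟨?_, ?_⟩ <;> rw [Nat.mul_add]
  · exact Nat.add_le_add h.1 h'.1
  · exact Nat.add_le_add h.2 h'.2

theorem trans (h : Comparable K a b) (h' : Comparable K' b c) : Comparable (K * K') a c := by
  refine ⟨?_, ?_⟩
  · rw [Nat.mul_assoc]; exact h.1.trans (Nat.mul_le_mul_left _ h'.1)
  · rw [Nat.mul_comm K, Nat.mul_assoc]; exact h'.2.trans (Nat.mul_le_mul_left _ h.2)

theorem refl (hK : 1 ≤ K) : Comparable K a a :=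
  ⟨Nat.le_mul_of_pos_left _ hK, Nat.le_mul_of_pos_left _ hK⟩

/-- Positive numbers whose difference is bounded are comparable. -/
theorem of_le_add (ha : 1 ≤ a) (hb : 1 ≤ b) (h : a ≤ b + K) (h' : b ≤ a + K) :
    Comparable (K + 1) a b := by
  refine ⟨?_, ?_⟩ <;> nlinarith

end Comparable

/-- A size and a distance on an alphabet. -/
structure LetterMetric (Γ : Type*) where
  /-- the size of a letter -/
  size : Γ → ℕ
  /-- the distance of two letters -/
  dist : Γ → Γ → ℕ

namespace LetterMetric

variable {Γ Δ : Type*} (M : LetterMetric Γ) (N : LetterMetric Δ)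

/-- The total size of the letters of a list. -/
def weight (l : List Γ) : ℕ := (l.map M.size).sum

@[simp] theorem weight_nil : M.weight [] = 0 := rfl

@[simp] theorem weight_cons (a : Γ) (l : List Γ) : M.weight (a :: l) = M.size a + M.weight l := by
  simp [weight]

@[simp] theorem weight_append (l l' : List Γ) :
    M.weight (l ++ l') = M.weight l + M.weight l' := by
  simp [weight]

open Classical in
/-- The distance of two lists: delete the longest common prefix, compare the first letters
of the remainders, and add the sizes of all the other letters. -/
noncomputable def listDist : List Γ → List Γ → ℕ
  | [], l' => M.weight l'
  | a :: l, [] => M.weight (a :: l)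
  | a :: l, b :: l' => if a = b then listDist l l' else M.dist a b + M.weight l + M.weight l'

@[simp] theorem listDist_nil_left (l : List Γ) : M.listDist [] l = M.weight l := by
  simp [listDist]

@[simp] theorem listDist_nil_right (l : List Γ) : M.listDist l [] = M.weight l := by
  cases l <;> simp [listDist]

@[simp] theorem listDist_cons_self (a : Γ) (l l' : List Γ) :
    M.listDist (a :: l) (a :: l') = M.listDist l l' := by
  simp [listDist]

theorem listDist_cons_of_ne {a b : Γ} (h : a ≠ b) (l l' : List Γ) :
    M.listDist (a :: l) (b :: l') = M.dist a b + M.weight l + M.weight l' := by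
  simp [listDist, h]

@[simp] theorem listDist_append_left (u l l' : List Γ) :
    M.listDist (u ++ l) (u ++ l') = M.listDist l l' := by
  induction u <;> simp_all

theorem listDist_append_of_incomparable {u v : List Γ} (h : ¬ u <+: v) (h' : ¬ v <+: u)
    (l l' : List Γ) :
    M.listDist (u ++ l) (v ++ l') = M.listDist u v + M.weight l + M.weight l' := by
  induction u generalizing v with
  | nil => simp at h
  | cons a u ih =>
    cases v with
    | nil => simp at h'
    | cons b v =>
      by_cases hab : a = b
      · subst hab
        simp only [List.cons_prefix_cons, true_and] at h h'
        simpa using ih h h'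
      · simp only [List.cons_append, M.listDist_cons_of_ne hab, weight_append]
        omega

/-- Appending letters to a list moves it by at most the weight of these letters. -/
theorem listDist_append_le (h : ∀ a b, M.dist a b ≤ M.size a + M.size b)
    (l r l' : List Γ) : M.listDist (l ++ r) l' ≤ M.listDist l l' + M.weight r := by
  have key : ∀ l l', M.listDist l l' ≤ M.weight l + M.weight l' := by
    intro l
    induction l with
    | nil => simp
    | cons a l ih =>
      intro l'
      cases l' with
      | nil => simp
      | cons b l' =>
        by_cases hab : a = b
        · subst hab
          have := ih l'
          simp only [listDist_cons_self, weight_cons]; omega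
        · have := h a b
          simp only [M.listDist_cons_of_ne hab, weight_cons]; omega
  induction l generalizing l' with
  | nil => have := key r l'; simp; omega
  | cons a l ih =>
    cases l' with
    | nil => simp; omega
    | cons b l' =>
      by_cases hab : a = b
      · subst hab; simpa using ih l'
      · simp only [List.cons_append, M.listDist_cons_of_ne hab, weight_append]; omega

theorem listDist_le_append (h : ∀ a b, M.size b ≤ M.dist a b + M.size a)
    (l r l' : List Γ) : M.listDist l l' ≤ M.listDist (l ++ r) l' + M.weight r := by
  have key : ∀ l l', M.weight l' ≤ M.listDist l l' + M.weight l := by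
    intro l
    induction l with
    | nil => simp
    | cons a l ih =>
      intro l'
      cases l' with
      | nil => simp
      | cons b l' =>
        by_cases hab : a = b
        · subst hab
          have := ih l'
          simp only [listDist_cons_self, weight_cons]; omega
        · have := h a b
          simp only [M.listDist_cons_of_ne hab, weight_cons]; omega
  induction l generalizing l' with
  | nil => have := key r l'; simp; omega
  | cons a l ih =>
    cases l' with
    | nil => simp; omega
    | cons b l' =>
      by_cases hab : a = b
      · subst hab; simpa using ih l'
      · simp only [List.cons_append, M.listDist_cons_of_ne hab, weight_append]; omega

end LetterMetric

/-- A code with finite-state memory: the letter `a` read in the state `s` is replaced by the list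
`emit s a`, and the state becomes `next s a`. -/
def encodeList {S Γ Δ : Type*} (emit : S → Γ → List Δ) (next : S → Γ → S) : S → List Γ → List Δ
  | _, [] => []
  | s, a :: l => emit s a ++ encodeList emit next (next s a) l

namespace LetterMetric

variable {S Γ Δ : Type*} (M : LetterMetric Γ) (N : LetterMetric Δ)

theorem comparable_weight_encodeList {emit : S → Γ → List Δ} {next : S → Γ → S} {K : ℕ}
    (hsize : ∀ s a, Comparable K (N.weight (emit s a)) (M.size a)) (s : S) (l : List Γ) :
    Comparable K (N.weight (encodeList emit next s l)) (M.weight l) := by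
  induction l generalizing s with
  | nil => simp [encodeList, Comparable]
  | cons a l ih => simpa [encodeList] using (hsize s a).add (ih _)

/-- A prefix code that distorts sizes and distances of letters by bounded factors does the same
with lists. -/
theorem comparable_listDist_encodeList {emit : S → Γ → List Δ} {next : S → Γ → S} {K : ℕ}
    (hsize : ∀ s a, Comparable K (N.weight (emit s a)) (M.size a))
    (hdist : ∀ s a b, a ≠ b → Comparable K (N.listDist (emit s a) (emit s b)) (M.dist a b))
    (hcode : ∀ s a b, a ≠ b → ¬ emit s a <+: emit s b) (s : S) (l l' : List Γ) :
    Comparable K (N.listDist (encodeList emit next s l) (encodeList emit next s l'))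
      (M.listDist l l') := by
  have hw := M.comparable_weight_encodeList N (next := next) hsize
  induction l generalizing s l' with
  | nil => simpa [encodeList] using hw s l'
  | cons a l ih =>
    cases l' with
    | nil => simpa only [encodeList, listDist_nil_right] using hw s (a :: l)
    | cons b l' =>
      by_cases hab : a = b
      · subst hab; simpa [encodeList] using ih _ _
      · rw [M.listDist_cons_of_ne hab, encodeList, encodeList,
          N.listDist_append_of_incomparable (hcode s a b hab) (hcode s b a (Ne.symm hab))]
        exact ((hdist s a b hab).add (hw _ _)).add (hw _ _)

theorem comparable_listDist_map {f : Γ → Δ} (hf : Function.Injective f) {K : ℕ}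
    (hsize : ∀ a, Comparable K (N.size (f a)) (M.size a))
    (hdist : ∀ a b, a ≠ b → Comparable K (N.dist (f a) (f b)) (M.dist a b)) (l l' : List Γ) :
    Comparable K (N.listDist (l.map f) (l'.map f)) (M.listDist l l') := by
  have key : ∀ l : List Γ, encodeList (fun (_ : Unit) a => [f a]) (fun s _ => s) () l
      = l.map f := by
    intro l; induction l <;> simp_all [encodeList]
  rw [← key, ← key]
  refine M.comparable_listDist_encodeList N (fun _ a => by simpa using hsize a)
    (fun _ a b hab => ?_) (fun _ a b hab => by simpa using fun h => hab (hf h)) () l l'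
  simpa [N.listDist_cons_of_ne (hf.ne hab)] using hdist a b hab

end LetterMetric

/-! ### Splitting the binary tree -/

/-- The metric on bits for which `listDist` is the distance in the rooted binary tree. -/
def bitMetric : LetterMetric Bool := ⟨fun _ => 1, fun _ _ => 2⟩

@[simp] theorem bitMetric_size (b : Bool) : bitMetric.size b = 1 := rfl

@[simp] theorem bitMetric_dist (a b : Bool) : bitMetric.dist a b = 2 := rfl

@[simp] theorem bitMetric_weight (l : List Bool) : bitMetric.weight l = l.length := by
  induction l with
  | nil => rfl
  | cons a l ih => simp [ih]; omega

theorem bitMetric_listDist_le (l l' : List Bool) :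
    bitMetric.listDist l l' ≤ l.length + l'.length := by
  have := bitMetric.listDist_append_le (by simp) [] l l'
  simp at this; omega

theorem bitMetric_listDist_pos {l l' : List Bool} (h : l ≠ l') : 1 ≤ bitMetric.listDist l l' := by
  induction l generalizing l' with
  | nil => cases l' <;> simp_all
  | cons a l ih =>
    cases l' with
    | nil => simp
    | cons b l' =>
      by_cases hab : a = b
      · subst hab; simpa using ih (by simpa using h)
      · rw [bitMetric.listDist_cons_of_ne hab]; simp; omega

/-- For `i = 0, …, k - 1` these maps are injective with disjoint images that cover all lists
of bits. -/
def splitBits (k i : ℕ) (h : List Bool) : List Bool :=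
  if i + 1 < k then List.replicate i true ++ false :: h
  else if h = List.replicate h.length true then h else List.replicate i true ++ h

theorem length_splitBits_le (k i : ℕ) (h : List Bool) :
    (splitBits k i h).length ≤ h.length + (i + 1) := by
  unfold splitBits; split_ifs <;> simp <;> omega

theorem le_length_splitBits (k i : ℕ) (h : List Bool) :
    h.length ≤ (splitBits k i h).length := by
  unfold splitBits; split_ifs <;> grind

theorem eq_replicate_or_exists_false (h : List Bool) :
    h = List.replicate h.length true ∨
      ∃ m h', h = List.replicate m true ++ false :: h' := by
  induction h with
  | nil => simp
  | cons a h ih =>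
    cases a with
    | false => exact Or.inr ⟨0, h, rfl⟩
    | true =>
      rcases ih with ih | ⟨m, h', ih⟩
      · exact Or.inl (by simpa [List.replicate_succ] using ih)
      · exact Or.inr ⟨m + 1, h', by simp [List.replicate_succ, ih]⟩

theorem false_notMem_of_eq_replicate {h : List Bool} (e : h = List.replicate h.length true) :
    false ∉ h := by
  intro hf
  rw [e] at hf
  exact absurd (List.eq_of_mem_replicate hf) (by simp)

theorem not_prefix_splitBits {k i j : ℕ} (hij : i < j) (h : List Bool) :
    ¬ (List.replicate i true ++ [false]) <+: splitBits k j h := by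
  have key : ∀ r : List Bool, ¬ (List.replicate i true ++ [false]) <+:
      List.replicate j true ++ r := by
    rintro r ⟨t, e⟩
    obtain ⟨m, rfl⟩ := Nat.exists_eq_add_of_lt hij
    rw [show i + m + 1 = i + (m + 1) by omega, ← List.replicate_append_replicate] at e
    simp [List.replicate_succ] at e
  unfold splitBits
  split_ifs with h1 h2
  · exact key _
  · rintro ⟨t, e⟩
    exact false_notMem_of_eq_replicate h2 (by rw [← e]; simp)
  · exact key _

theorem le_listDist_of_incomparable (i : ℕ) (h z : List Bool)
    (hz : ¬ (List.replicate i true ++ [false]) <+: z) :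
    h.length + z.length ≤ bitMetric.listDist (List.replicate i true ++ false :: h) z + 2 * i := by
  induction i generalizing z with
  | zero =>
    cases z with
    | nil => simp
    | cons b z =>
      cases b with
      | false => simp at hz
      | true => simp [bitMetric.listDist_cons_of_ne]; omega
  | succ i ih =>
    cases z with
    | nil => simp; omega
    | cons b z =>
      cases b with
      | false => simp [List.replicate_succ, bitMetric.listDist_cons_of_ne]; omega
      | true =>
        simp only [List.replicate_succ, List.cons_append, List.cons_prefix_cons, true_and] at hz
        have := ih z hz
        simp [List.replicate_succ]; omega

theorem le_listDist_splitBits_of_lt {k i j : ℕ} (hij : i < j) (hj : j < k) (h h' : List Bool) :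
    h.length + h'.length ≤ bitMetric.listDist (splitBits k i h) (splitBits k j h') + 2 * k := by
  have h1 := le_listDist_of_incomparable i h _ (not_prefix_splitBits (k := k) hij h')
  have h2 := le_length_splitBits k j h'
  have h3 : splitBits k i h = List.replicate i true ++ false :: h := by
    rw [splitBits, if_pos (by omega)]
  rw [h3]; omega

theorem LetterMetric.listDist_comm {Γ : Type*} (M : LetterMetric Γ)
    (h : ∀ a b, M.dist a b = M.dist b a) (l l' : List Γ) :
    M.listDist l l' = M.listDist l' l := by
  induction l generalizing l' with
  | nil => simp
  | cons a l ih =>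
    cases l' with
    | nil => simp
    | cons b l' =>
      by_cases hab : a = b
      · subst hab; simpa using ih l'
      · rw [M.listDist_cons_of_ne hab, M.listDist_cons_of_ne (Ne.symm hab), h]; omega

theorem bitMetric_listDist_comm (l l' : List Bool) :
    bitMetric.listDist l l' = bitMetric.listDist l' l :=
  bitMetric.listDist_comm (fun _ _ => rfl) l l'

theorem le_listDist_splitBits {k i j : ℕ} (hij : i ≠ j) (hi : i < k) (hj : j < k)
    (h h' : List Bool) :
    h.length + h'.length ≤ bitMetric.listDist (splitBits k i h) (splitBits k j h') + 2 * k := by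
  rcases Nat.lt_or_gt_of_ne hij with hij | hij
  · exact le_listDist_splitBits_of_lt hij hj h h'
  · have := le_listDist_splitBits_of_lt hij hi h' h
    rw [bitMetric_listDist_comm]; omega

theorem listDist_splitBits_bounds (k i : ℕ) (h h' : List Bool) :
    bitMetric.listDist (splitBits k i h) (splitBits k i h') ≤ bitMetric.listDist h h' + i ∧
      bitMetric.listDist h h' ≤ bitMetric.listDist (splitBits k i h) (splitBits k i h') + i := by
  have key : ∀ m : ℕ, ∀ r : List Bool,
      bitMetric.listDist (List.replicate m true) (List.replicate i true ++ r) ≤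
        bitMetric.listDist (List.replicate m true) r + i ∧
      bitMetric.listDist (List.replicate m true) r ≤
        bitMetric.listDist (List.replicate m true) (List.replicate i true ++ r) + i := by
    intro m r
    have h1 := bitMetric.listDist_append_le (by simp) (List.replicate m true)
      (List.replicate i true) (List.replicate i true ++ r)
    have h2 := bitMetric.listDist_le_append (by simp) (List.replicate m true)
      (List.replicate i true) (List.replicate i true ++ r)
    rw [List.replicate_append_replicate, Nat.add_comm m i, ← List.replicate_append_replicate,
      bitMetric.listDist_append_left] at h1 h2
    simp at h1 h2
    omega
  unfold splitBits
  split_ifs with h1 h2 h3 h3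
  · simp
  · simp
  · rw [h2]; exact key _ _
  · rw [h3, bitMetric_listDist_comm, bitMetric_listDist_comm h]; exact key _ _
  · simp

theorem splitBits_injective {k i j : ℕ} (hi : i < k) (hj : j < k) {h h' : List Bool}
    (e : splitBits k i h = splitBits k j h') : i = j ∧ h = h' := by
  have key : ∀ {i j : ℕ} {h h' : List Bool}, i < j → j < k →
      splitBits k i h ≠ splitBits k j h' := by
    intro i j h h' hij hj e
    refine not_prefix_splitBits (k := k) hij h' ⟨h, ?_⟩
    rw [← e, splitBits, if_pos (by omega)]; simp
  rcases lt_trichotomy i j with hij | rfl | hij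
  · exact absurd e (key hij hj)
  · refine ⟨rfl, ?_⟩
    have aux : ∀ r : List Bool, List.replicate i true ++ r =
        List.replicate (List.replicate i true ++ r).length true →
        r = List.replicate r.length true := by
      intro r e
      refine List.eq_replicate_iff.2 ⟨rfl, fun b hb => ?_⟩
      have := (List.eq_replicate_iff.1 e).2 b (by simp [hb])
      exact this
    unfold splitBits at e
    split_ifs at e with h1 h2 h3 h3
    · simpa using e
    · exact e
    · exact absurd (aux h' (e ▸ h2)) h3
    · exact absurd (aux h (e ▸ h3)) h2
    · simpa using e
  · exact absurd e.symm (key hij hi)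

theorem splitBits_surjective {k : ℕ} (hk : 1 ≤ k) (z : List Bool) :
    ∃ i < k, ∃ h, splitBits k i h = z := by
  rcases eq_replicate_or_exists_false z with hz | ⟨m, h', rfl⟩
  · exact ⟨k - 1, by omega, z, by rw [splitBits, if_neg (by omega), if_pos hz]⟩
  · by_cases hm : m + 1 < k
    · exact ⟨m, by omega, h', by rw [splitBits, if_pos hm]⟩
    · refine ⟨k - 1, by omega, List.replicate (m - (k - 1)) true ++ false :: h', ?_⟩
      rw [splitBits, if_neg (by omega), if_neg, ← List.append_assoc,
        List.replicate_append_replicate, show k - 1 + (m - (k - 1)) = m by omega]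
      exact fun e => false_notMem_of_eq_replicate e (by simp)

/-! ### Trees of spaces as sets of lists -/

namespace LetterMetric

variable {Y Y' : Type*} (M : LetterMetric Y) (M' : LetterMetric Y')

/-- Adjoin two letters of size one, at the largest possible distance from the others. -/
def withBits : LetterMetric (Bool ⊕ Y) where
  size := Sum.elim (fun _ => 1) M.size
  dist
    | .inl _, .inl _ => 2
    | .inl _, .inr y => 1 + M.size y
    | .inr y, .inl _ => M.size y + 1
    | .inr y, .inr y' => M.dist y y'

open Classical in
/-- Attach a rooted binary tree to every letter. -/
noncomputable def withTrees : LetterMetric (Y × List Bool) where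
  size a := M.size a.1 + a.2.length
  dist a b := if a.1 = b.1 then bitMetric.listDist a.2 b.2
    else M.dist a.1 b.1 + a.2.length + b.2.length

@[simp] theorem withBits_size_inl (b : Bool) : M.withBits.size (.inl b) = 1 := rfl

@[simp] theorem withBits_size_inr (y : Y) : M.withBits.size (.inr y) = M.size y := rfl

@[simp] theorem withBits_dist_inl_inl (b b' : Bool) :
    M.withBits.dist (.inl b) (.inl b') = 2 := rfl

@[simp] theorem withBits_dist_inl_inr (b : Bool) (y : Y) :
    M.withBits.dist (.inl b) (.inr y) = 1 + M.size y := rfl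

@[simp] theorem withBits_dist_inr_inl (b : Bool) (y : Y) :
    M.withBits.dist (.inr y) (.inl b) = M.size y + 1 := rfl

@[simp] theorem withBits_dist_inr_inr (y y' : Y) :
    M.withBits.dist (.inr y) (.inr y') = M.dist y y' := rfl

@[simp] theorem withTrees_size (a : Y × List Bool) :
    M.withTrees.size a = M.size a.1 + a.2.length := rfl

@[simp] theorem withBits_weight_map_inl (h : List Bool) :
    M.withBits.weight (h.map .inl) = h.length := by
  induction h with
  | nil => rfl
  | cons b h ih => simp [ih]; omega

/-- The list of letters from `Bool ⊕ Y` in which every letter from `Y` is followed by the bits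
attached to it. -/
def joinBits (l : List (Y × List Bool)) : List (Bool ⊕ Y) :=
  l.flatMap fun a => .inr a.1 :: a.2.map .inl

@[simp] theorem joinBits_nil : joinBits ([] : List (Y × List Bool)) = [] := rfl

@[simp] theorem joinBits_cons (a : Y × List Bool) (l : List (Y × List Bool)) :
    joinBits (a :: l) = .inr a.1 :: (a.2.map .inl ++ joinBits l) := by
  simp [joinBits]

/-- Cut a list after every maximal block of bits. -/
def cutBits : List (Bool ⊕ Y) → List Bool × List (Y × List Bool)
  | [] => ([], [])
  | .inl b :: l => (b :: (cutBits l).1, (cutBits l).2)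
  | .inr y :: l => ([], (y, (cutBits l).1) :: (cutBits l).2)

theorem map_append_joinBits_cutBits (l : List (Bool ⊕ Y)) :
    (cutBits l).1.map .inl ++ joinBits (cutBits l).2 = l := by
  induction l with
  | nil => rfl
  | cons a l ih => cases a <;> simp [cutBits, ih]

theorem cutBits_map_append_joinBits (h : List Bool) (l : List (Y × List Bool)) :
    cutBits (h.map .inl ++ joinBits l) = (h, l) := by
  induction l generalizing h with
  | nil =>
    induction h with
    | nil => rfl
    | cons b h ih =>
      simp only [List.map_cons, List.cons_append, cutBits, ih]
  | cons a l ihl =>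
    induction h with
    | nil => simp [cutBits, ihl]
    | cons b h ih =>
      simp only [List.map_cons, List.cons_append, cutBits, ih]

theorem weight_joinBits (l : List (Y × List Bool)) :
    M.withBits.weight (joinBits l) = M.withTrees.weight l := by
  induction l with
  | nil => rfl
  | cons a l ih => simp [ih]; omega

open Classical in
theorem listDist_map_append_joinBits_aux (h h' : List Bool) (l l' : List (Y × List Bool)) :
    M.withBits.listDist (h.map .inl ++ joinBits l) (h'.map .inl ++ joinBits l') =
      if h = h' then M.withBits.listDist (joinBits l) (joinBits l')
      else bitMetric.listDist h h' + M.withTrees.weight l + M.withTrees.weight l' := by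
  induction h generalizing h' with
  | nil =>
    cases h' with
    | nil => simp
    | cons b h' =>
      cases l with
      | nil => simp [weight_joinBits]; try omega
      | cons a l => simp [listDist_cons_of_ne, weight_joinBits]; omega
  | cons b h ih =>
    cases h' with
    | nil =>
      cases l' with
      | nil => simp [weight_joinBits]; try omega
      | cons a l => simp [listDist_cons_of_ne, weight_joinBits]; omega
    | cons b' h' =>
      by_cases hb : b = b'
      · subst hb; simpa using ih h'
      · simp [listDist_cons_of_ne, weight_joinBits, hb]; omega

theorem listDist_joinBits (l l' : List (Y × List Bool)) :
    M.withBits.listDist (joinBits l) (joinBits l') = M.withTrees.listDist l l' := by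
  classical
  induction l generalizing l' with
  | nil => simp [weight_joinBits]
  | cons a l ih =>
    cases l' with
    | nil => simp [weight_joinBits]; omega
    | cons a' l' =>
      obtain ⟨y, h⟩ := a
      obtain ⟨y', h'⟩ := a'
      by_cases hy : y = y'
      · subst hy
        rw [joinBits_cons, joinBits_cons, listDist_cons_self, listDist_map_append_joinBits_aux]
        by_cases hh : h = h'
        · subst hh; simpa using ih l'
        · rw [if_neg hh, listDist_cons_of_ne _ (by simpa using hh)]
          simp [withTrees]
      · rw [listDist_cons_of_ne _ (by simp [hy]), joinBits_cons, joinBits_cons,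
          listDist_cons_of_ne _ (by simpa using hy)]
        simp [withTrees, hy, weight_joinBits]; omega

open Classical in
theorem listDist_map_append_joinBits (h h' : List Bool) (l l' : List (Y × List Bool)) :
    M.withBits.listDist (h.map .inl ++ joinBits l) (h'.map .inl ++ joinBits l') =
      if h = h' then M.withTrees.listDist l l'
      else bitMetric.listDist h h' + M.withTrees.weight l + M.withTrees.weight l' := by
  rw [listDist_map_append_joinBits_aux, listDist_joinBits]

/-- A bijection between letters with trees, distorting sizes and distances by bounded factors,
induces one between lists of bits and letters. -/
theorem exists_surjective_comparable_of_withTrees (f : Y × List Bool → Y' × List Bool)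
    (hf : Function.Bijective f) {K : ℕ} (hK : 1 ≤ K)
    (hsize : ∀ a, Comparable K (M'.withTrees.size (f a)) (M.withTrees.size a))
    (hdist : ∀ a b, a ≠ b → Comparable K (M'.withTrees.dist (f a) (f b)) (M.withTrees.dist a b)) :
    ∃ g : List (Bool ⊕ Y) → List (Bool ⊕ Y'), Function.Surjective g ∧ g [] = [] ∧
      ∀ l l', Comparable K (M'.withBits.listDist (g l) (g l')) (M.withBits.listDist l l') := by
  classical
  have hD := M.withTrees.comparable_listDist_map M'.withTrees hf.injective hsize hdist
  have hw : ∀ l, Comparable K (M'.withTrees.weight (l.map f)) (M.withTrees.weight l) := by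
    intro l; simpa using hD [] l
  refine ⟨fun l => (cutBits l).1.map .inl ++ joinBits ((cutBits l).2.map f), ?_, rfl, ?_⟩
  · intro l
    obtain ⟨u, hu⟩ := hf.surjective.list_map (cutBits l).2
    refine ⟨(cutBits l).1.map .inl ++ joinBits u, ?_⟩
    simp only [cutBits_map_append_joinBits, hu, map_append_joinBits_cutBits]
  · intro l l'
    rw [← map_append_joinBits_cutBits l, ← map_append_joinBits_cutBits l']
    generalize cutBits l = u
    generalize cutBits l' = v
    simp only [cutBits_map_append_joinBits, listDist_map_append_joinBits]
    split_ifs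
    · exact hD _ _
    · exact ((Comparable.refl hK).add (hw _)).add (hw _)

end LetterMetric

theorem Comparable.add_of_le_add {K m a b x y : ℕ} (hK : 1 ≤ K) (h : Comparable K a b)
    (ha : 1 ≤ a) (hb : 1 ≤ b) (hx : x ≤ y + m) (hy : y ≤ x + m) :
    Comparable (K + m) (a + x) (b + y) := by
  obtain ⟨h1, h2⟩ := h
  constructor <;> nlinarith [Nat.zero_le (m * x), Nat.zero_le (m * y), Nat.mul_le_mul_left m ha,
    Nat.mul_le_mul_left m hb, Nat.mul_le_mul_right x hK, Nat.mul_le_mul_right y hK]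

theorem exists_fiber_index {X Y Λ : Type*} [Finite Λ] (π : X → Y) (hπ : Function.Surjective π)
    (label : X → Λ) (hlabel : ∀ a b, π a = π b → label a = label b → a = b) :
    ∃ (k : Y → ℕ) (idx : X → ℕ), (∀ y, 1 ≤ k y ∧ k y ≤ Nat.card Λ) ∧
      (∀ a, idx a < k (π a)) ∧ (∀ a b, π a = π b → idx a = idx b → a = b) ∧
      ∀ y, ∀ i < k y, ∃ a, π a = y ∧ idx a = i := by
  have inj : ∀ y, Function.Injective fun a : {a // π a = y} => label a := fun y a b e =>
    Subtype.ext (hlabel _ _ (a.2.trans b.2.symm) e)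
  have fin : ∀ y, Finite {a // π a = y} := fun y => Finite.of_injective _ (inj y)
  have key : ∀ a, ∀ y, ∀ h : π a = y,
      (Finite.equivFin {b // π b = π a} ⟨a, rfl⟩ : ℕ) = Finite.equivFin {b // π b = y} ⟨a, h⟩ := by
    rintro a _ rfl; rfl
  refine ⟨fun y => Nat.card {a // π a = y},
    fun a => Finite.equivFin {b // π b = π a} ⟨a, rfl⟩, fun y => ⟨?_, ?_⟩, fun a => Fin.is_lt _,
    ?_, ?_⟩
  · obtain ⟨a, ha⟩ := hπ y
    have : Nonempty {a // π a = y} := ⟨⟨a, ha⟩⟩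
    exact Nat.card_pos
  · exact Nat.card_le_card_of_injective _ (inj y)
  · intro a b hab e
    have h : Finite.equivFin {b' // π b' = π b} ⟨a, hab⟩ =
        Finite.equivFin {b' // π b' = π b} ⟨b, rfl⟩ := Fin.ext ((key a _ hab).symm.trans e)
    simpa using h
  · intro y i hi
    let u := (Finite.equivFin {b // π b = y}).symm ⟨i, hi⟩
    exact ⟨u.1, u.2, (key u.1 _ u.2).trans (by simp [u])⟩

namespace LetterMetric

variable {Y Y' : Type*} (M : LetterMetric Y) (M' : LetterMetric Y')

/-- A finite-to-one surjection of alphabets that distorts sizes and distances by bounded factors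
induces a surjection of the sets of lists with two additional letters. -/
theorem exists_surjective_comparable_of_finite_fibers {Λ : Type*} [Finite Λ] (π : Y → Y')
    (hπ : Function.Surjective π) (label : Y → Λ)
    (hlabel : ∀ a b, π a = π b → label a = label b → a = b) {K : ℕ} (hK : 1 ≤ K)
    (hpos : ∀ a, 1 ≤ M.size a) (hdpos : ∀ a b, a ≠ b → 1 ≤ M.dist a b)
    (hsize : ∀ a, Comparable K (M'.size (π a)) (M.size a))
    (hdist : ∀ a b, π a ≠ π b → Comparable K (M'.dist (π a) (π b)) (M.dist a b))
    (hfiber : ∀ a b, π a = π b → M.dist a b ≤ K) :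
    ∃ K', 1 ≤ K' ∧ ∃ g : List (Bool ⊕ Y) → List (Bool ⊕ Y'), Function.Surjective g ∧ g [] = [] ∧
      ∀ l l', Comparable K' (M'.withBits.listDist (g l) (g l')) (M.withBits.listDist l l') := by
  obtain ⟨k, idx, hk, hidx, hinj, hsurj⟩ := exists_fiber_index π hπ label hlabel
  set m := Nat.card Λ
  have hpos' : ∀ {a b}, Comparable K a b → 1 ≤ b → 1 ≤ a := by
    intro a b h hb
    have := h.2
    rcases Nat.eq_zero_or_pos a with rfl | ha <;> omega
  have hle : ∀ a h, (splitBits (k (π a)) (idx a) h).length ≤ h.length + m := by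
    intro a h
    have := length_splitBits_le (k (π a)) (idx a) h
    have := hidx a
    have := (hk (π a)).2
    omega
  have hge : ∀ a h, h.length ≤ (splitBits (k (π a)) (idx a) h).length := fun a h =>
    le_length_splitBits _ _ _
  refine ⟨K + 2 * m + 1, by omega, M.exists_surjective_comparable_of_withTrees M'
    (fun a => (π a.1, splitBits (k (π a.1)) (idx a.1) a.2)) ⟨?_, ?_⟩ (by omega) ?_ ?_⟩
  · rintro ⟨a, h⟩ ⟨b, h'⟩ e
    simp only [Prod.mk.injEq] at e
    obtain ⟨e1, e2⟩ := e
    have hb := hidx b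
    rw [← e1] at e2 hb
    obtain ⟨e3, rfl⟩ := splitBits_injective (hidx a) hb e2
    rw [hinj a b e1 e3]
  · rintro ⟨y, z⟩
    obtain ⟨i, hi, h, rfl⟩ := splitBits_surjective (hk y).1 z
    obtain ⟨a, rfl, rfl⟩ := hsurj y i hi
    exact ⟨(a, h), rfl⟩
  · rintro ⟨a, h⟩
    have h1 := hle a h
    have h2 := hge a h
    simp only [withTrees_size]
    exact ((hsize a).add_of_le_add hK (hpos' (hsize a) (hpos a)) (hpos a) (m := m)
      h1 (by omega)).mono (by omega)
  · rintro ⟨a, h⟩ ⟨b, h'⟩ hab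
    have h1 := hle a h
    have h2 := hge a h
    have h3 := hle b h'
    have h4 := hge b h'
    by_cases hπab : π a = π b
    · by_cases haa : a = b
      · subst haa
        have hh : h ≠ h' := by simpa using hab
        have hb := listDist_splitBits_bounds (k (π a)) (idx a) h h'
        have hi := hidx a
        have hkm := (hk (π a)).2
        simp only [withTrees, if_true]
        refine (Comparable.of_le_add (K := m) (bitMetric_listDist_pos fun e => hh ?_)
          (bitMetric_listDist_pos hh) ?_ ?_).mono (by omega)
        · exact (splitBits_injective hi hi e).2
        · omega
        · omega
      · have hidx' := hidx b
        rw [← hπab] at hidx'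
        have hne : idx a ≠ idx b := fun e => haa (hinj a b hπab e)
        have hl := le_listDist_splitBits hne (hidx a) hidx' h h'
        have hu := bitMetric_listDist_le (splitBits (k (π a)) (idx a) h)
          (splitBits (k (π a)) (idx b) h')
        have hfib := hfiber a b hπab
        have hd := hdpos a b haa
        have hkm := (hk (π a)).2
        simp only [withTrees, haa, if_false, if_pos hπab]
        rw [← hπab] at h3 h4 ⊢
        refine Comparable.of_le_add (K := K + 2 * m) (bitMetric_listDist_pos fun e => hne ?_)
          ?_ ?_ ?_
        · exact (splitBits_injective (hidx a) hidx' e).1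
        all_goals omega
    · have haa : a ≠ b := fun e => hπab (e ▸ rfl)
      simp only [withTrees, haa, hπab, if_false, Nat.add_assoc]
      exact ((hdist a b hπab).add_of_le_add hK (hpos' (hdist a b hπab) (hdpos a b haa))
        (hdpos a b haa) (m := 2 * m) (by omega) (by omega)).mono (by omega)

end LetterMetric

/-! ### Amalgamated products -/

/-- A length function on a group that vanishes only at the identity. -/
structure IsLength {G : Type*} [Group G] (ℓ : G → ℕ) : Prop where
  map_one : ℓ 1 = 0
  eq_one : ∀ g, ℓ g = 0 → g = 1
  map_mul_le : ∀ g h, ℓ (g * h) ≤ ℓ g + ℓ h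
  map_inv : ∀ g, ℓ g⁻¹ = ℓ g

theorem IsLength.pos {G : Type*} [Group G] {ℓ : G → ℕ} (hℓ : IsLength ℓ) {g : G} (hg : g ≠ 1) :
    1 ≤ ℓ g :=
  Nat.pos_of_ne_zero fun h => hg (hℓ.eq_one g h)

section Words

variable {ι : Type*} {G : ι → Type*} [∀ i, Group (G i)]

open Classical in
/-- The elements of several groups as letters; elements of different groups are as far apart as
their lengths allow. -/
noncomputable def lengthMetric (ℓ : ∀ i, G i → ℕ) : LetterMetric (Σ i, G i) where
  size a := ℓ a.1 a.2
  dist a b := if h : a.1 = b.1 then ℓ b.1 ((h ▸ a.2)⁻¹ * b.2) else ℓ a.1 a.2 + ℓ b.1 b.2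

variable {ℓ : ∀ i, G i → ℕ}

@[simp] theorem lengthMetric_size (a : Σ i, G i) : (lengthMetric ℓ).size a = ℓ a.1 a.2 := rfl

theorem lengthMetric_dist_same (i : ι) (g h : G i) :
    (lengthMetric ℓ).dist ⟨i, g⟩ ⟨i, h⟩ = ℓ i (g⁻¹ * h) := by
  simp [lengthMetric]

theorem lengthMetric_dist_of_ne {a b : Σ i, G i} (h : a.1 ≠ b.1) :
    (lengthMetric ℓ).dist a b = ℓ a.1 a.2 + ℓ b.1 b.2 := by
  simp [lengthMetric, h]

theorem lengthMetric_dist_le (hℓ : ∀ i, IsLength (ℓ i)) (a b : Σ i, G i) :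
    (lengthMetric ℓ).dist a b ≤ ℓ a.1 a.2 + ℓ b.1 b.2 := by
  obtain ⟨i, g⟩ := a
  obtain ⟨j, h⟩ := b
  by_cases hij : i = j
  · subst hij
    rw [lengthMetric_dist_same, ← (hℓ i).map_inv g]
    exact (hℓ i).map_mul_le _ _
  · rw [lengthMetric_dist_of_ne hij]

theorem lengthMetric_dist_comm (hℓ : ∀ i, IsLength (ℓ i)) (a b : Σ i, G i) :
    (lengthMetric ℓ).dist a b = (lengthMetric ℓ).dist b a := by
  obtain ⟨i, g⟩ := a
  obtain ⟨j, h⟩ := b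
  by_cases hij : i = j
  · subst hij
    rw [lengthMetric_dist_same, lengthMetric_dist_same, ← (hℓ i).map_inv]
    simp
  · rw [lengthMetric_dist_of_ne hij, lengthMetric_dist_of_ne (Ne.symm hij), Nat.add_comm]

theorem lengthMetric_size_le (hℓ : ∀ i, IsLength (ℓ i)) (a b : Σ i, G i) :
    ℓ a.1 a.2 ≤ (lengthMetric ℓ).dist a b + ℓ b.1 b.2 := by
  obtain ⟨i, g⟩ := a
  obtain ⟨j, h⟩ := b
  by_cases hij : i = j
  · subst hij
    have := (hℓ i).map_mul_le (g⁻¹ * h) h⁻¹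
    rw [(hℓ i).map_inv, mul_inv_cancel_right, (hℓ i).map_inv] at this
    rwa [lengthMetric_dist_same]
  · rw [lengthMetric_dist_of_ne hij]; omega

theorem lengthMetric_triangle (hℓ : ∀ i, IsLength (ℓ i)) (a b c : Σ i, G i) :
    (lengthMetric ℓ).dist a c ≤ (lengthMetric ℓ).dist a b + (lengthMetric ℓ).dist b c := by
  by_cases hab : a.1 = b.1
  · by_cases hbc : b.1 = c.1
    · obtain ⟨i, g⟩ := a
      obtain ⟨j, h⟩ := b
      obtain ⟨k, x⟩ := c
      obtain rfl : i = j := hab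
      obtain rfl : i = k := hbc
      simp only [lengthMetric_dist_same]
      have := (hℓ i).map_mul_le (g⁻¹ * h) (h⁻¹ * x)
      rwa [mul_assoc, mul_inv_cancel_left] at this
    · have := lengthMetric_size_le hℓ a b
      rw [lengthMetric_dist_of_ne (hab.trans_ne hbc), lengthMetric_dist_of_ne hbc]
      omega
  · have := lengthMetric_dist_le hℓ a c
    have := lengthMetric_size_le hℓ c b
    rw [lengthMetric_dist_comm hℓ c b] at this
    rw [lengthMetric_dist_of_ne hab]
    omega

theorem lengthMetric_dist_pos (hℓ : ∀ i, IsLength (ℓ i)) {a b : Σ i, G i} (hab : a ≠ b)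
    (hb : b.2 ≠ 1) : 1 ≤ (lengthMetric ℓ).dist a b := by
  obtain ⟨i, g⟩ := a
  obtain ⟨j, h⟩ := b
  by_cases hij : i = j
  · subst hij
    rw [lengthMetric_dist_same]
    refine (hℓ i).pos fun e => hab ?_
    rw [inv_mul_eq_one.1 e]
  · rw [lengthMetric_dist_of_ne hij]
    exact ((hℓ j).pos hb).trans (Nat.le_add_left _ _)

/-- The element of a group represented by a word. -/
def evalWord {Q : Type*} [Group Q] (e : ∀ i, G i →* Q) (w : List (Σ i, G i)) : Q :=
  (w.map fun a => e a.1 a.2).prod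

@[simp] theorem evalWord_nil {Q : Type*} [Group Q] (e : ∀ i, G i →* Q) : evalWord e [] = 1 := rfl

@[simp] theorem evalWord_cons {Q : Type*} [Group Q] (e : ∀ i, G i →* Q) (a : Σ i, G i)
    (w : List (Σ i, G i)) : evalWord e (a :: w) = e a.1 a.2 * evalWord e w := by
  simp [evalWord]

@[simp] theorem evalWord_append {Q : Type*} [Group Q] (e : ∀ i, G i →* Q)
    (w w' : List (Σ i, G i)) : evalWord e (w ++ w') = evalWord e w * evalWord e w' := by
  simp [evalWord]

/-- The formal inverse of a word. -/
def invWord (w : List (Σ i, G i)) : List (Σ i, G i) :=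
  (w.map fun a => ⟨a.1, a.2⁻¹⟩).reverse

@[simp] theorem invWord_cons (a : Σ i, G i) (w : List (Σ i, G i)) :
    invWord (a :: w) = invWord w ++ [⟨a.1, a.2⁻¹⟩] := by
  simp [invWord]

@[simp] theorem evalWord_invWord {Q : Type*} [Group Q] (e : ∀ i, G i →* Q)
    (w : List (Σ i, G i)) : evalWord e (invWord w) = (evalWord e w)⁻¹ := by
  induction w with
  | nil => simp [invWord]
  | cons a w ih => simp [ih]

theorem weight_invWord (hℓ : ∀ i, IsLength (ℓ i)) (w : List (Σ i, G i)) :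
    (lengthMetric ℓ).weight (invWord w) = (lengthMetric ℓ).weight w := by
  induction w with
  | nil => rfl
  | cons a w ih => simp [ih, (hℓ a.1).map_inv, Nat.add_comm]

/-- A word is reduced relative to a family of subgroups if consecutive letters belong to different
groups and no letter lies in the subgroup. -/
def IsReducedWord (F : ∀ i, Subgroup (G i)) (w : List (Σ i, G i)) : Prop :=
  (w.map Sigma.fst).IsChain (· ≠ ·) ∧ ∀ a ∈ w, a.2 ∉ F a.1

variable {F : ∀ i, Subgroup (G i)}

theorem isReducedWord_nil : IsReducedWord F [] := by simp [IsReducedWord]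

theorem IsReducedWord.of_cons {a : Σ i, G i} {w : List (Σ i, G i)}
    (h : IsReducedWord F (a :: w)) : IsReducedWord F w :=
  ⟨h.1.tail, fun b hb => h.2 b (List.mem_cons_of_mem _ hb)⟩

theorem IsReducedWord.replace_head {i : ι} {g h : G i} {w : List (Σ i, G i)}
    (hw : IsReducedWord F (⟨i, g⟩ :: w)) (hh : h ∉ F i) : IsReducedWord F (⟨i, h⟩ :: w) := by
  refine ⟨by simpa using hw.1, fun b hb => ?_⟩
  rcases List.mem_cons.1 hb with rfl | hb
  · exact hh
  · exact hw.2 b (List.mem_cons_of_mem _ hb)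

theorem IsReducedWord.invWord {w : List (Σ i, G i)} (hw : IsReducedWord F w) :
    IsReducedWord F (invWord w) := by
  refine ⟨?_, fun b hb => ?_⟩
  · have : (_root_.invWord w).map Sigma.fst = (w.map Sigma.fst).reverse := by
      simp [_root_.invWord, Function.comp_def]
    rw [this, List.isChain_reverse]
    simpa only [ne_comm] using hw.1
  · simp only [_root_.invWord, List.mem_reverse, List.mem_map] at hb
    obtain ⟨a, ha, rfl⟩ := hb
    simpa using hw.2 a ha

/-- The quotient of two reduced words that differ essentially in their first letters is
represented by a reduced word. -/
theorem IsReducedWord.exists_quotient {Q : Type*} [Group Q] (e : ∀ i, G i →* Q)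
    (hℓ : ∀ i, IsLength (ℓ i)) {a b : Σ i, G i} {w w' : List (Σ i, G i)}
    (hw : IsReducedWord F (a :: w)) (hw' : IsReducedWord F (b :: w'))
    (hab : ∀ h : a.1 = b.1, (h ▸ a.2)⁻¹ * b.2 ∉ F b.1) :
    ∃ v, IsReducedWord F v ∧ v ≠ [] ∧
      evalWord e v = (evalWord e (a :: w))⁻¹ * evalWord e (b :: w') ∧
      (lengthMetric ℓ).weight v =
        (lengthMetric ℓ).dist a b + (lengthMetric ℓ).weight w + (lengthMetric ℓ).weight w' := by
  obtain ⟨i, g⟩ := a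
  obtain ⟨j, h⟩ := b
  have hi := hw.invWord
  by_cases hij : i = j
  · subst hij
    have hgh : g⁻¹ * h ∉ F i := hab rfl
    refine ⟨_root_.invWord w ++ ⟨i, g⁻¹ * h⟩ :: w', ⟨?_, fun b hb => ?_⟩, by simp, ?_, ?_⟩
    · rw [List.map_append, List.map_cons, List.isChain_split]
      exact ⟨by simpa using hi.1, hw'.1⟩
    · rcases List.mem_append.1 hb with hb | hb
      · exact hw.of_cons.invWord.2 b hb
      · exact (hw'.replace_head hgh).2 b hb
    · simp [mul_assoc]
    · rw [lengthMetric_dist_same, LetterMetric.weight_append, weight_invWord hℓ]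
      simp; omega
  · refine ⟨_root_.invWord (⟨i, g⟩ :: w) ++ ⟨j, h⟩ :: w', ⟨?_, fun b hb => ?_⟩, by simp, ?_, ?_⟩
    · simp only [invWord_cons, List.map_append, List.append_assoc, List.map_cons,
        List.cons_append, List.nil_append]
      rw [List.isChain_append_cons_cons]
      exact ⟨by simpa using hi.1, hij, hw'.1⟩
    · rcases List.mem_append.1 hb with hb | hb
      · exact hi.2 b hb
      · exact hw'.2 b hb
    · rw [evalWord_append, evalWord_invWord]
    · rw [lengthMetric_dist_of_ne hij, LetterMetric.weight_append, weight_invWord hℓ]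
      simp; omega

end Words

section Amalgam

variable {ι : Type*} {G : ι → Type*} [∀ i, Group (G i)] {Q : Type*} [Group Q]

/-- The properties of the maps from the factors to an amalgamated product that determine its
geometry: the subgroups `F i` are identified, and there is a normal form theorem. -/
structure IsAmalgam (F : ∀ i, Subgroup (G i)) (e : ∀ i, G i →* Q) : Prop where
  exists_eq : ∀ i j, ∀ f ∈ F i, ∃ f' ∈ F j, e j f' = e i f
  eq_nil : ∀ w, IsReducedWord F w → evalWord e w = 1 → w = []

/-- A length function on `Q` that is the word length for the elements of the factors of
length one. -/
structure IsFactorLength (ℓ : ∀ i, G i → ℕ) (e : ∀ i, G i →* Q) (N : Q → ℕ) : Prop where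
  map_one : N 1 = 0
  map_mul_le : ∀ x y, N (x * y) ≤ N x + N y
  map_inv : ∀ x, N x⁻¹ = N x
  map_factor_le : ∀ i g, N (e i g) ≤ ℓ i g
  exists_word : ∀ x, ∃ w, evalWord e w = x ∧ (∀ a ∈ w, ℓ a.1 a.2 ≤ 1) ∧ w.length ≤ N x

/-- The common image of the subgroups `F i`. -/
def IsBaseElement (F : ∀ i, Subgroup (G i)) (e : ∀ i, G i →* Q) (z : Q) : Prop :=
  ∀ i, ∃ f ∈ F i, e i f = z

/-- A choice of representatives of the left cosets of a subgroup. -/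
structure IsTransversal {G : Type*} [Group G] (F : Subgroup G) (τ : G → G) : Prop where
  map_one : τ 1 = 1
  mem : ∀ g, (τ g)⁻¹ * g ∈ F
  eq : ∀ g h, g⁻¹ * h ∈ F → τ g = τ h

/-- An alternating word whose letters are representatives of nontrivial cosets. -/
def IsCosetWord (τ : ∀ i, G i → G i) (w : List (Σ i, G i)) : Prop :=
  (w.map Sigma.fst).IsChain (· ≠ ·) ∧ ∀ a ∈ w, τ a.1 a.2 = a.2 ∧ a.2 ≠ 1

variable {F : ∀ i, Subgroup (G i)} {e : ∀ i, G i →* Q} {ℓ : ∀ i, G i → ℕ} {N : Q → ℕ}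
  {τ : ∀ i, G i → G i}

theorem IsTransversal.map_map {G : Type*} [Group G] {F : Subgroup G} {τ : G → G}
    (hτ : IsTransversal F τ) (g : G) : τ (τ g) = τ g :=
  hτ.eq _ _ (hτ.mem g)

theorem IsTransversal.mem_of_eq_one {G : Type*} [Group G] {F : Subgroup G} {τ : G → G}
    (hτ : IsTransversal F τ) {g : G} (hg : τ g = 1) : g ∈ F := by
  simpa [hg] using hτ.mem g

theorem IsTransversal.eq_one_of_mem {G : Type*} [Group G] {F : Subgroup G} {τ : G → G}
    (hτ : IsTransversal F τ) {g : G} (hg : g ∈ F) : τ g = 1 := by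
  rw [← hτ.map_one]
  exact (hτ.eq _ _ (by simpa using hg)).symm

theorem IsCosetWord.isReducedWord (hτ : ∀ i, IsTransversal (F i) (τ i)) {w : List (Σ i, G i)}
    (hw : IsCosetWord τ w) : IsReducedWord F w := by
  refine ⟨hw.1, fun a ha h => (hw.2 a ha).2 ?_⟩
  rw [← (hw.2 a ha).1, (hτ a.1).eq_one_of_mem h]

theorem IsCosetWord.of_cons {a : Σ i, G i} {w : List (Σ i, G i)}
    (h : IsCosetWord τ (a :: w)) : IsCosetWord τ w :=
  ⟨h.1.tail, fun b hb => h.2 b (List.mem_cons_of_mem _ hb)⟩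

namespace IsAmalgam

variable (hQ : IsAmalgam F e)
include hQ

theorem isBaseElement {i : ι} {f : G i} (hf : f ∈ F i) : IsBaseElement F e (e i f) :=
  fun j => hQ.exists_eq i j f hf

theorem exists_left_mul (hℓ : ∀ i, IsLength (ℓ i)) {c : ℕ} (hc : ∀ i, ∀ f ∈ F i, ℓ i f ≤ c)
    (i : ι) (s : G i) {z : Q} (hz : IsBaseElement F e z) {w : List (Σ i, G i)}
    (hw : IsReducedWord F w) :
    ∃ z' w', IsBaseElement F e z' ∧ IsReducedWord F w' ∧
      e i s * (z * evalWord e w) = z' * evalWord e w' ∧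
      (lengthMetric ℓ).weight w' ≤ (ℓ i s + c) + (lengthMetric ℓ).weight w := by
  obtain ⟨f, hf, rfl⟩ := hz i
  have hone : IsBaseElement F e 1 := fun j => ⟨1, one_mem _, map_one _⟩
  have hlen : ℓ i (s * f) ≤ ℓ i s + c :=
    ((hℓ i).map_mul_le _ _).trans (Nat.add_le_add_left (hc i f hf) _)
  by_cases hsf : s * f ∈ F i
  · exact ⟨e i (s * f), w, hQ.isBaseElement hsf, hw, by simp [mul_assoc], by omega⟩
  have hcons : (∀ j ∈ (w.map Sigma.fst).head?, i ≠ j) →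
      IsReducedWord F (⟨i, s * f⟩ :: w) := by
    intro h
    refine ⟨by simpa [List.isChain_cons] using ⟨by simpa using h, hw.1⟩, fun a ha => ?_⟩
    rcases List.mem_cons.1 ha with rfl | ha
    · exact hsf
    · exact hw.2 a ha
  cases w with
  | nil =>
    exact ⟨1, [⟨i, s * f⟩], hone, hcons (by simp), by simp, by simpa using hlen⟩
  | cons a t =>
    obtain ⟨j, g⟩ := a
    by_cases hij : i = j
    · subst hij
      by_cases hg : s * f * g ∈ F i
      · refine ⟨e i (s * f * g), t, hQ.isBaseElement hg, hw.of_cons, by simp [mul_assoc], ?_⟩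
        simp; omega
      · refine ⟨1, ⟨i, s * f * g⟩ :: t, hone, hw.replace_head hg, by simp [mul_assoc], ?_⟩
        have := (hℓ i).map_mul_le (s * f) g
        simp; omega
    · refine ⟨1, ⟨i, s * f⟩ :: ⟨j, g⟩ :: t, hone, hcons (by simpa using hij),
        by simp [mul_assoc], ?_⟩
      simp; omega

theorem exists_isReducedWord (hℓ : ∀ i, IsLength (ℓ i)) {c : ℕ}
    (hc : ∀ i, ∀ f ∈ F i, ℓ i f ≤ c) (hN : IsFactorLength ℓ e N) (x : Q) :
    ∃ z w, IsBaseElement F e z ∧ IsReducedWord F w ∧ x = z * evalWord e w ∧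
      (lengthMetric ℓ).weight w ≤ (1 + c) * N x := by
  obtain ⟨u, rfl, hu, hlen⟩ := hN.exists_word x
  obtain ⟨z, w, hz, hw, h, hle⟩ : ∃ z w, IsBaseElement F e z ∧ IsReducedWord F w ∧
      evalWord e u = z * evalWord e w ∧ (lengthMetric ℓ).weight w ≤ (1 + c) * u.length := by
    clear hlen
    induction u with
    | nil => exact ⟨1, [], fun j => ⟨1, one_mem _, map_one _⟩, isReducedWord_nil, by simp, by simp⟩
    | cons a u ih =>
      obtain ⟨z, w, hz, hw, h, hle⟩ := ih fun b hb => hu b (List.mem_cons_of_mem _ hb)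
      obtain ⟨z', w', hz', hw', h', hle'⟩ := hQ.exists_left_mul hℓ hc a.1 a.2 hz hw
      refine ⟨z', w', hz', hw', by rw [evalWord_cons, h, h'], ?_⟩
      have := hu a List.mem_cons_self
      rw [List.length_cons, Nat.mul_succ]
      omega
  exact ⟨z, w, hz, hw, h, hle.trans (Nat.mul_le_mul_left _ hlen)⟩

/-- Reduced words that represent the same element up to a base element have comparable weights. -/
theorem weight_le_of_eq_mul (hℓ : ∀ i, IsLength (ℓ i)) {c : ℕ}
    (hc : ∀ i, ∀ f ∈ F i, ℓ i f ≤ c) {w w' : List (Σ i, G i)} (hw : IsReducedWord F w)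
    (hw' : IsReducedWord F w') {z : Q} (hz : IsBaseElement F e z)
    (h : evalWord e w = z * evalWord e w') :
    (lengthMetric ℓ).weight w ≤ (1 + 2 * c) * (lengthMetric ℓ).weight w' := by
  induction w generalizing w' z with
  | nil => simp
  | cons a t ih =>
    obtain ⟨i, g⟩ := a
    have hgF : g ∉ F i := hw.2 _ List.mem_cons_self
    cases w' with
    | nil =>
      obtain ⟨f, hf, rfl⟩ := hz i
      have : IsReducedWord F (⟨i, f⁻¹ * g⟩ :: t) :=
        hw.replace_head fun h' => hgF ((Subgroup.mul_mem_cancel_left _ (inv_mem hf)).1 h')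
      have := hQ.eq_nil _ this (by
        simp only [evalWord_cons, evalWord_nil, mul_one] at h
        simp [mul_assoc, h])
      simp at this
    | cons b t' =>
      obtain ⟨j, g'⟩ := b
      have hgF' : g' ∉ F j := hw'.2 _ List.mem_cons_self
      obtain ⟨f, hf, rfl⟩ := hz j
      have hred : IsReducedWord F (⟨j, f * g'⟩ :: t') :=
        hw'.replace_head fun h' => hgF' ((Subgroup.mul_mem_cancel_left _ hf).1 h')
      have heq : evalWord e (⟨i, g⟩ :: t) = evalWord e (⟨j, f * g'⟩ :: t') := by
        rw [h]; simp [mul_assoc]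
      by_cases hab : ∀ h : i = j, (h ▸ g)⁻¹ * (f * g') ∉ F j
      · obtain ⟨v, hv, hne, hev, -⟩ := hw.exists_quotient e hℓ hred hab
        exact absurd (hQ.eq_nil v hv (by rw [hev, heq, inv_mul_cancel])) hne
      · push Not at hab
        obtain ⟨rfl, hab⟩ := hab
        simp only at hab
        have h1 := ih hw.of_cons hw'.of_cons (hQ.isBaseElement hab) (by
          simp only [evalWord_cons] at heq
          rw [map_mul, mul_assoc, ← heq]; simp)
        have h2 : ℓ i g ≤ 2 * c + ℓ i g' := by
          have h3 := (hℓ i).map_mul_le f (g' * (g⁻¹ * (f * g'))⁻¹)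
          have h4 := (hℓ i).map_mul_le g' (g⁻¹ * (f * g'))⁻¹
          have h5 := hc i _ (inv_mem hab)
          have h6 := hc i f hf
          have h7 : f * (g' * (g⁻¹ * (f * g'))⁻¹) = g := by group
          rw [h7] at h3
          omega
        have h3 : 1 ≤ ℓ i g' := (hℓ i).pos fun h => hgF' (h ▸ one_mem _)
        simp only [LetterMetric.weight_cons, lengthMetric_size]
        nlinarith

theorem weight_le (hℓ : ∀ i, IsLength (ℓ i)) {c : ℕ} (hc : ∀ i, ∀ f ∈ F i, ℓ i f ≤ c)
    (hN : IsFactorLength ℓ e N) {w : List (Σ i, G i)} (hw : IsReducedWord F w) :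
    (lengthMetric ℓ).weight w ≤ (1 + 2 * c) * (1 + c) * N (evalWord e w) := by
  obtain ⟨z, w', hz, hw', h, hle⟩ := hQ.exists_isReducedWord hℓ hc hN (evalWord e w)
  rw [mul_assoc]
  exact (hQ.weight_le_of_eq_mul hℓ hc hw hw' hz h).trans (Nat.mul_le_mul_left _ hle)

omit hQ in
theorem _root_.IsFactorLength.le_weight (hN : IsFactorLength ℓ e N) (w : List (Σ i, G i)) :
    N (evalWord e w) ≤ (lengthMetric ℓ).weight w := by
  induction w with
  | nil => simp [hN.map_one]
  | cons a w ih =>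
    have := hN.map_mul_le (e a.1 a.2) (evalWord e w)
    have := hN.map_factor_le a.1 a.2
    simp; omega

/-- Coset words are embedded bilipschitzly in the amalgamated product. -/
theorem comparable_listDist (hτ : ∀ i, IsTransversal (F i) (τ i)) (hℓ : ∀ i, IsLength (ℓ i))
    {c : ℕ} (hc : ∀ i, ∀ f ∈ F i, ℓ i f ≤ c) (hN : IsFactorLength ℓ e N)
    {w w' : List (Σ i, G i)} (hw : IsCosetWord τ w) (hw' : IsCosetWord τ w') :
    Comparable ((1 + 2 * c) * (1 + c)) (N ((evalWord e w)⁻¹ * evalWord e w'))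
      ((lengthMetric ℓ).listDist w w') := by
  obtain ⟨v, hv, hev, hwt⟩ : ∃ v, IsReducedWord F v ∧
      evalWord e v = (evalWord e w)⁻¹ * evalWord e w' ∧
      (lengthMetric ℓ).weight v = (lengthMetric ℓ).listDist w w' := by
    induction w generalizing w' with
    | nil => exact ⟨w', hw'.isReducedWord hτ, by simp, by simp⟩
    | cons a t ih =>
      cases w' with
      | nil =>
        exact ⟨invWord (a :: t), (hw.isReducedWord hτ).invWord, by rw [evalWord_invWord]; simp,
          by rw [weight_invWord hℓ, LetterMetric.listDist_nil_right]⟩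
      | cons b t' =>
        by_cases hab : a = b
        · subst hab
          obtain ⟨v, hv, hev, hwt⟩ := ih hw.of_cons hw'.of_cons
          exact ⟨v, hv, by rw [hev]; simp [mul_assoc], by simpa using hwt⟩
        · obtain ⟨v, hv, -, hev, hwt⟩ := (hw.isReducedWord hτ).exists_quotient e hℓ
            (hw'.isReducedWord hτ) (by
              obtain ⟨i, g⟩ := a
              obtain ⟨j, h⟩ := b
              intro hij hF
              obtain rfl : i = j := hij
              apply hab
              have h1 := (hw.2 _ List.mem_cons_self).1
              have h2 := (hw'.2 _ List.mem_cons_self).1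
              have h3 := (hτ i).eq _ _ hF
              simp only at h1 h2
              rw [← h1, ← h2, h3])
          exact ⟨v, hv, hev, by rw [hwt, LetterMetric.listDist_cons_of_ne _ hab]⟩
  rw [← hev, ← hwt]
  refine ⟨(hN.le_weight v).trans (Nat.le_mul_of_pos_left _ (by positivity)),
    hQ.weight_le hℓ hc hN hv⟩

theorem exists_isCosetWord (hτ : ∀ i, IsTransversal (F i) (τ i)) (hℓ : ∀ i, IsLength (ℓ i))
    {c : ℕ} (hc : ∀ i, ∀ f ∈ F i, ℓ i f ≤ c) (hN : IsFactorLength ℓ e N) (x : Q) :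
    ∃ w z, IsCosetWord τ w ∧ IsBaseElement F e z ∧ x = evalWord e w * z := by
  have key : ∀ w : List (Σ i, G i), (∀ a ∈ w, a.2 ∉ F a.1) → ∀ z, IsBaseElement F e z →
      ∃ v z', v.map Sigma.fst = w.map Sigma.fst ∧ (∀ a ∈ v, τ a.1 a.2 = a.2 ∧ a.2 ≠ 1) ∧
        IsBaseElement F e z' ∧ z * evalWord e w = evalWord e v * z' := by
    intro w
    induction w with
    | nil => exact fun _ z hz => ⟨[], z, rfl, by simp, hz, by simp⟩
    | cons a w ih =>
      intro hw z hz
      obtain ⟨i, g⟩ := a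
      obtain ⟨f, hf, rfl⟩ := hz i
      have hg : g ∉ F i := hw _ List.mem_cons_self
      obtain ⟨v, z', hv, hv', hz', h⟩ := ih (fun b hb => hw b (List.mem_cons_of_mem _ hb)) _
        (hQ.isBaseElement ((hτ i).mem (f * g)))
      refine ⟨⟨i, τ i (f * g)⟩ :: v, z', by simp [hv], ?_, hz', ?_⟩
      · intro b hb
        rcases List.mem_cons.1 hb with rfl | hb
        · exact ⟨(hτ i).map_map _, fun h' =>
            hg ((Subgroup.mul_mem_cancel_left _ hf).1 ((hτ i).mem_of_eq_one h'))⟩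
        · exact hv' b hb
      · rw [evalWord_cons, evalWord_cons, mul_assoc, ← h]
        simp only [← mul_assoc, ← map_mul]
        simp
  obtain ⟨z, w, hz, hw, h, -⟩ := hQ.exists_isReducedWord hℓ hc hN x
  obtain ⟨v, z', hv, hv', hz', h'⟩ := key w hw.2 z hz
  exact ⟨v, z', ⟨hv ▸ hw.1, hv'⟩, hz', h.trans h'⟩

end IsAmalgam

end Amalgam

/-! ### Amalgamated products as sets of lists of letters -/

/-- The restriction of sizes and distances along a map. -/
def LetterMetric.comap {Γ Δ : Type*} (M : LetterMetric Δ) (f : Γ → Δ) : LetterMetric Γ :=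
  ⟨fun a => M.size (f a), fun a b => M.dist (f a) (f b)⟩

/-- `f` is a quasi-isometry with respect to the given distances. -/
def IsCoarseEquivalence {X Y : Type*} (dX : X → X → ℕ) (dY : Y → Y → ℕ) (f : X → Y) : Prop :=
  ∃ K, (∀ a b, dY (f a) (f b) ≤ K * (dX a b + 1) ∧ dX a b ≤ K * (dY (f a) (f b) + 1)) ∧
    ∀ y, ∃ x, dY (f x) y ≤ K

/-- The distance on nonempty lists with letters from `Bool ⊕ Y` beginning with a bit. -/
noncomputable def LetterMetric.rootedDist {Y : Type*} (M : LetterMetric Y)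
    (u v : Bool × List (Bool ⊕ Y)) : ℕ :=
  M.withBits.listDist (.inl u.1 :: u.2) (.inl v.1 :: v.2)

section Code

variable {G : Bool → Type*} [∀ i, Group (G i)]

/-- The nontrivial coset representatives. -/
def IsCosetLetter (τ : ∀ i, G i → G i) (a : Σ i, G i) : Prop := τ a.1 a.2 = a.2 ∧ a.2 ≠ 1

/-- Three coset letters that play a special role in the encoding of words. -/
structure IsPivot (τ : ∀ i, G i → G i) (x y z : Σ i, G i) : Prop where
  left : IsCosetLetter τ x
  right : IsCosetLetter τ y
  right' : IsCosetLetter τ z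
  fst_ne : x.1 ≠ y.1
  fst_eq : z.1 = y.1
  ne : y ≠ z

/-- The coset letters other than the three special ones. -/
abbrev OtherLetter (τ : ∀ i, G i → G i) (x y z : Σ i, G i) : Type _ :=
  {a : Σ i, G i // IsCosetLetter τ a ∧ a ≠ x ∧ a ≠ y ∧ a ≠ z}

/-- The sizes and distances of the letters other than the three special ones. -/
noncomputable def otherMetric (ℓ : ∀ i, G i → ℕ) (τ : ∀ i, G i → G i) (x y z : Σ i, G i) :
    LetterMetric (OtherLetter τ x y z) :=
  (lengthMetric ℓ).comap Subtype.val

variable {τ : ∀ i, G i → G i} (x y z : Σ i, G i)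

/-- The special letter that is used to change the type of the next letter. -/
def switchLetter (s : Bool) : Σ i, G i := if s = x.1 then y else x

/-- The coset letter represented by a letter of the code. -/
def codeLetter (s : Bool) : Bool ⊕ OtherLetter τ x y z → Σ i, G i
  | .inl true => z
  | .inl false => if s = x.1 then x else y
  | .inr a => a.1

/-- Write a letter after a letter of type `s`. -/
def emitLetter (s : Bool) (a : Σ i, G i) : List (Σ i, G i) :=
  if a.1 = s then [switchLetter x y s, a] else [a]

/-- The word represented by a list of letters of the code, following a letter of type `s`. -/
def decodeWord (s : Bool) (l : List (Bool ⊕ OtherLetter τ x y z)) : List (Σ i, G i) :=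
  encodeList (fun s σ => emitLetter x y s (codeLetter x y z s σ))
    (fun s σ => (codeLetter x y z s σ).1) s l

variable {x y z} {ℓ : ∀ i, G i → ℕ}

omit [∀ i, Group (G i)] in
theorem length_switchLetter_le {m : ℕ} (hx : ℓ x.1 x.2 ≤ m) (hy : ℓ y.1 y.2 ≤ m) (s : Bool) :
    ℓ (switchLetter x y s).1 (switchLetter x y s).2 ≤ m := by
  rcases ite_eq_or_eq (s = x.1) y x with h | h <;> rw [switchLetter, h] <;> assumption

theorem length_codeLetter_inl_le {m : ℕ} (hx : ℓ x.1 x.2 ≤ m) (hy : ℓ y.1 y.2 ≤ m)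
    (hz : ℓ z.1 z.2 ≤ m) (s b : Bool) :
    ℓ (codeLetter (τ := τ) x y z s (.inl b)).1 (codeLetter (τ := τ) x y z s (.inl b)).2 ≤ m := by
  cases b
  · rcases ite_eq_or_eq (s = x.1) x y with h | h <;> rw [codeLetter, h] <;> assumption
  · exact hz

namespace IsPivot

variable (h : IsPivot τ x y z)
include h

theorem switchLetter_fst_ne (s : Bool) : (switchLetter x y s).1 ≠ s := by
  have := h.fst_ne
  unfold switchLetter
  split_ifs with hs
  · rw [hs]; exact this.symm
  · exact Ne.symm hs

theorem isCosetLetter_switchLetter (s : Bool) : IsCosetLetter τ (switchLetter x y s) := by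
  unfold switchLetter
  split_ifs
  exacts [h.right, h.left]

theorem isCosetLetter_codeLetter (s : Bool) (σ : Bool ⊕ OtherLetter τ x y z) :
    IsCosetLetter τ (codeLetter x y z s σ) := by
  match s, σ with
  | s, .inl true => exact h.right'
  | s, .inl false =>
    unfold codeLetter
    split_ifs
    exacts [h.left, h.right]
  | s, .inr a => exact a.2.1

theorem x_ne_y : x ≠ y := fun e => h.fst_ne (e ▸ rfl)

theorem x_ne_z : x ≠ z := fun e => h.fst_ne (e ▸ h.fst_eq)

theorem codeLetter_injective (s : Bool) :
    Function.Injective (codeLetter (τ := τ) x y z s) := by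
  have h1 := h.x_ne_y
  have h2 := h.x_ne_z
  have h3 := h.ne
  intro σ σ' e
  match σ, σ' with
  | .inl true, .inl true => rfl
  | .inl false, .inl false => rfl
  | .inl true, .inl false =>
    simp only [codeLetter] at e; split_ifs at e <;> simp_all
  | .inl false, .inl true =>
    simp only [codeLetter] at e; split_ifs at e <;> simp_all
  | .inl true, .inr a => exact absurd e.symm a.2.2.2.2
  | .inr a, .inl true => exact absurd e a.2.2.2.2
  | .inl false, .inr a =>
    have := a.2.2
    simp only [codeLetter] at e; split_ifs at e <;> simp_all
  | .inr a, .inl false =>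
    have := a.2.2
    simp only [codeLetter] at e; split_ifs at e <;> simp_all
  | .inr a, .inr b => rw [Subtype.ext e]

theorem codeLetter_ne (s : Bool) (σ : Bool ⊕ OtherLetter τ x y z) :
    codeLetter x y z s σ ≠ switchLetter x y s := by
  have h1 := h.x_ne_y
  have h2 := h.x_ne_z
  have h3 := h.ne
  match σ with
  | .inl true => simp only [codeLetter, switchLetter]; split_ifs <;> simp_all [eq_comm]
  | .inl false => simp only [codeLetter, switchLetter]; split_ifs <;> simp_all [eq_comm]
  | .inr a =>
    have := a.2.2
    simp only [codeLetter, switchLetter]; split_ifs <;> simp_all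

omit h in
theorem exists_codeLetter (s : Bool) {a : Σ i, G i} (ha : IsCosetLetter τ a)
    (hs : a ≠ switchLetter x y s) : ∃ σ : Bool ⊕ OtherLetter τ x y z, codeLetter x y z s σ = a := by
  by_cases hz : a = z
  · exact ⟨.inl true, hz.symm⟩
  by_cases hx : a = x
  · refine ⟨.inl false, ?_⟩
    simp only [codeLetter, switchLetter] at hs ⊢
    split_ifs at hs ⊢ <;> simp_all
  by_cases hy : a = y
  · refine ⟨.inl false, ?_⟩
    simp only [codeLetter, switchLetter] at hs ⊢
    split_ifs at hs ⊢ <;> simp_all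
  · exact ⟨.inr ⟨a, ha, hx, hy, hz⟩, rfl⟩

theorem isChain_decodeWord (s : Bool) (l : List (Bool ⊕ OtherLetter τ x y z)) :
    (s :: (decodeWord x y z s l).map Sigma.fst).IsChain (· ≠ ·) ∧
      ∀ a ∈ decodeWord x y z s l, IsCosetLetter τ a := by
  induction l generalizing s with
  | nil => simp [decodeWord, encodeList]
  | cons σ l ih =>
    obtain ⟨h1, h2⟩ := ih (codeLetter x y z s σ).1
    have h3 := h.isCosetLetter_codeLetter s σ
    have h4 := h.isCosetLetter_switchLetter s
    have h5 := h.switchLetter_fst_ne s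
    unfold decodeWord at h1 h2 ⊢
    rw [encodeList]
    unfold emitLetter
    split_ifs with hs
    · refine ⟨?_, ?_⟩
      · simp only [List.cons_append, List.nil_append, List.map_cons, List.isChain_cons_cons]
        exact ⟨h5.symm, fun e => h5 (e.trans hs), h1⟩
      · intro a ha
        simp only [List.cons_append, List.nil_append, List.mem_cons] at ha
        rcases ha with rfl | rfl | ha
        exacts [h4, h3, h2 a ha]
    · refine ⟨?_, ?_⟩
      · simp only [List.cons_append, List.nil_append, List.map_cons, List.isChain_cons_cons]
        exact ⟨Ne.symm hs, h1⟩
      · intro a ha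
        simp only [List.cons_append, List.nil_append, List.mem_cons] at ha
        rcases ha with rfl | ha
        exacts [h3, h2 a ha]

theorem isCosetWord_decodeWord (s : Bool) (l : List (Bool ⊕ OtherLetter τ x y z)) :
    IsCosetWord τ (decodeWord x y z s l) :=
  ⟨(h.isChain_decodeWord s l).1.tail, (h.isChain_decodeWord s l).2⟩

theorem exists_decodeWord : ∀ (s : Bool) (w : List (Σ i, G i)),
    (s :: w.map Sigma.fst).IsChain (· ≠ ·) → (∀ a ∈ w, IsCosetLetter τ a) →
    ∃ (l : List (Bool ⊕ OtherLetter τ x y z)) (r : List (Σ i, G i)),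
      w = decodeWord x y z s l ++ r ∧ (r = [] ∨ ∃ t, r = [switchLetter x y t])
  | s, [], _, _ => ⟨[], [], rfl, Or.inl rfl⟩
  | s, a :: w, hw, hw' => by
    have ha := hw' a List.mem_cons_self
    simp only [List.map_cons, List.isChain_cons_cons] at hw
    by_cases hs : a = switchLetter x y s
    · match w with
      | [] => exact ⟨[], [a], rfl, Or.inr ⟨s, by rw [hs]⟩⟩
      | b :: w =>
        simp only [List.map_cons, List.isChain_cons_cons] at hw
        have hbs : b.1 = s := by
          have key : ∀ s i j : Bool, s ≠ i → i ≠ j → j = s := by decide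
          exact key _ _ _ hw.1 hw.2.1
        obtain ⟨σ, rfl⟩ := exists_codeLetter (x := x) (y := y) (z := z) s
          (hw' b (by simp)) (fun e => h.switchLetter_fst_ne s (e ▸ hbs))
        obtain ⟨l, r, e, hr⟩ := exists_decodeWord (codeLetter x y z s σ).1 w hw.2.2
          (fun a ha => hw' a (by simp [ha]))
        refine ⟨σ :: l, r, ?_, hr⟩
        rw [e, hs]
        simp [decodeWord, encodeList, emitLetter, hbs]
    · obtain ⟨σ, rfl⟩ := exists_codeLetter (x := x) (y := y) (z := z) s ha hs
      obtain ⟨l, r, e, hr⟩ := exists_decodeWord (codeLetter x y z s σ).1 w hw.2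
        (fun a ha => hw' a (by simp [ha]))
      refine ⟨σ :: l, r, ?_, hr⟩
      rw [e]
      simp [decodeWord, encodeList, emitLetter, Ne.symm hw.1]

omit h in
theorem comparable_weight_emitLetter (hℓ : ∀ i, IsLength (ℓ i)) {m : ℕ}
    (hx : ℓ x.1 x.2 ≤ m) (hy : ℓ y.1 y.2 ≤ m) (s : Bool) {a : Σ i, G i}
    (ha : IsCosetLetter τ a) :
    Comparable (m + 1) ((lengthMetric ℓ).weight (emitLetter x y s a))
      ((lengthMetric ℓ).size a) := by
  have h1 := (hℓ a.1).pos ha.2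
  have h2 := length_switchLetter_le hx hy s
  unfold emitLetter
  split_ifs
  · refine .of_le_add ?_ ?_ ?_ ?_ <;> (try simp) <;> omega
  · refine .of_le_add ?_ ?_ ?_ ?_ <;> (try simp) <;> omega

omit h in
theorem comparable_listDist_emitLetter (hℓ : ∀ i, IsLength (ℓ i)) {m : ℕ}
    (hx : ℓ x.1 x.2 ≤ m) (hy : ℓ y.1 y.2 ≤ m) (s : Bool) {a b : Σ i, G i} (hab : a ≠ b)
    (ha : IsCosetLetter τ a) (hb : IsCosetLetter τ b)
    (has : a ≠ switchLetter x y s) (hbs : b ≠ switchLetter x y s) :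
    Comparable (m + 1) ((lengthMetric ℓ).listDist (emitLetter x y s a) (emitLetter x y s b))
      ((lengthMetric ℓ).dist a b) := by
  have h1 := (hℓ a.1).pos ha.2
  have h1' := (hℓ b.1).pos hb.2
  have h2 := length_switchLetter_le hx hy s
  have h3 := lengthMetric_dist_pos hℓ hab hb.2
  unfold emitLetter
  split_ifs with has' hbs' hbs'
  · simp only [LetterMetric.listDist_cons_self, LetterMetric.listDist_cons_of_ne _ hab]
    exact .refl (by omega)
  · have h4 : a.1 ≠ b.1 := fun e => hbs' (e ▸ has')
    have h5 := lengthMetric_dist_le hℓ (switchLetter x y s) b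
    have h6 := lengthMetric_size_le hℓ b (switchLetter x y s)
    rw [lengthMetric_dist_comm hℓ] at h6
    rw [LetterMetric.listDist_cons_of_ne _ hbs.symm, lengthMetric_dist_of_ne h4]
    refine .of_le_add ?_ ?_ ?_ ?_ <;> (try simp) <;> omega
  · have h4 : a.1 ≠ b.1 := fun e => has' (e ▸ hbs')
    have h5 := lengthMetric_dist_le hℓ a (switchLetter x y s)
    have h6 := lengthMetric_size_le hℓ a (switchLetter x y s)
    rw [LetterMetric.listDist_cons_of_ne _ has, lengthMetric_dist_of_ne h4]
    refine .of_le_add ?_ ?_ ?_ ?_ <;> (try simp) <;> omega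
  · simp only [LetterMetric.listDist_cons_of_ne _ hab]
    exact .refl (by omega)

omit [∀ i, Group (G i)] h in
theorem not_prefix_emitLetter (s : Bool) {a b : Σ i, G i} (hab : a ≠ b)
    (has : a ≠ switchLetter x y s) : ¬ emitLetter x y s a <+: emitLetter x y s b := by
  unfold emitLetter
  split_ifs <;> simp_all [List.cons_prefix_cons]

theorem comparable_size_codeLetter (hℓ : ∀ i, IsLength (ℓ i)) {m : ℕ}
    (hx : ℓ x.1 x.2 ≤ m) (hy : ℓ y.1 y.2 ≤ m) (hz : ℓ z.1 z.2 ≤ m) (s : Bool)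
    (σ : Bool ⊕ OtherLetter τ x y z) :
    Comparable (m + 1) ((lengthMetric ℓ).size (codeLetter x y z s σ))
      ((otherMetric ℓ τ x y z).withBits.size σ) := by
  have h1 := (hℓ _).pos (h.isCosetLetter_codeLetter s σ).2
  match σ with
  | .inl b =>
    have h2 := length_codeLetter_inl_le (τ := τ) hx hy hz s b
    refine .of_le_add ?_ ?_ ?_ ?_ <;> (try simp) <;> omega
  | .inr a => exact .refl (by omega)

theorem comparable_dist_codeLetter (hℓ : ∀ i, IsLength (ℓ i)) {m : ℕ}
    (hx : ℓ x.1 x.2 ≤ m) (hy : ℓ y.1 y.2 ≤ m) (hz : ℓ z.1 z.2 ≤ m) (s : Bool)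
    {σ σ' : Bool ⊕ OtherLetter τ x y z} (hσ : σ ≠ σ') :
    Comparable (2 * m + 3)
      ((lengthMetric ℓ).dist (codeLetter x y z s σ) (codeLetter x y z s σ'))
      ((otherMetric ℓ τ x y z).withBits.dist σ σ') := by
  have h1 := lengthMetric_dist_pos hℓ ((h.codeLetter_injective s).ne hσ)
    (h.isCosetLetter_codeLetter s σ').2
  have h2 := length_codeLetter_inl_le (τ := τ) hx hy hz s
  have h3 := lengthMetric_dist_le hℓ (codeLetter x y z s σ) (codeLetter x y z s σ')
  have h4 := lengthMetric_size_le hℓ (codeLetter x y z s σ) (codeLetter x y z s σ')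
  have h5 := lengthMetric_size_le hℓ (codeLetter x y z s σ') (codeLetter x y z s σ)
  rw [lengthMetric_dist_comm hℓ] at h5
  match σ, σ' with
  | .inl b, .inl b' =>
    have := h2 b
    have := h2 b'
    refine (Comparable.of_le_add (K := 2 * m + 2) ?_ ?_ ?_ ?_) <;> (try simp) <;> omega
  | .inl b, .inr a =>
    have := h2 b
    have : (otherMetric ℓ τ x y z).size a =
      ℓ _ (codeLetter (τ := τ) x y z s (.inr a)).2 := rfl
    refine (Comparable.of_le_add (K := 2 * m + 2) ?_ ?_ ?_ ?_) <;> (try simp) <;> omega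
  | .inr a, .inl b =>
    have := h2 b
    have : (otherMetric ℓ τ x y z).size a =
      ℓ _ (codeLetter (τ := τ) x y z s (.inr a)).2 := rfl
    refine (Comparable.of_le_add (K := 2 * m + 2) ?_ ?_ ?_ ?_) <;> (try simp) <;> omega
  | .inr a, .inr a' => exact .refl (by omega)

theorem comparable_listDist_decodeWord (hℓ : ∀ i, IsLength (ℓ i)) {m : ℕ}
    (hx : ℓ x.1 x.2 ≤ m) (hy : ℓ y.1 y.2 ≤ m) (hz : ℓ z.1 z.2 ≤ m) (s : Bool)
    (l l' : List (Bool ⊕ OtherLetter τ x y z)) :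
    Comparable ((m + 1) * (2 * m + 3))
      ((lengthMetric ℓ).listDist (decodeWord x y z s l) (decodeWord x y z s l'))
      ((otherMetric ℓ τ x y z).withBits.listDist l l') := by
  refine LetterMetric.comparable_listDist_encodeList _ _ (fun s σ => ?_) (fun s σ σ' hσ => ?_)
    (fun s σ σ' hσ => ?_) s l l'
  · exact (comparable_weight_emitLetter hℓ hx hy s (h.isCosetLetter_codeLetter s σ)).trans
      ((h.comparable_size_codeLetter hℓ hx hy hz s σ).mono (by omega))
  · exact (comparable_listDist_emitLetter hℓ hx hy s ((h.codeLetter_injective s).ne hσ)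
      (h.isCosetLetter_codeLetter s σ) (h.isCosetLetter_codeLetter s σ')
      (h.codeLetter_ne s σ) (h.codeLetter_ne s σ')).trans
      (h.comparable_dist_codeLetter hℓ hx hy hz s hσ)
  · exact not_prefix_emitLetter s ((h.codeLetter_injective s).ne hσ) (h.codeLetter_ne s σ)

theorem listDist_decodeWord_of_ne {s s' : Bool} (hs : s ≠ s')
    (l l' : List (Bool ⊕ OtherLetter τ x y z)) :
    (lengthMetric ℓ).listDist (decodeWord x y z s l) (decodeWord x y z s' l') =
      (lengthMetric ℓ).weight (decodeWord x y z s l) +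
      (lengthMetric ℓ).weight (decodeWord x y z s' l') := by
  have h1 := (h.isChain_decodeWord s l).1
  have h2 := (h.isChain_decodeWord s' l').1
  generalize decodeWord x y z s l = w at *
  generalize decodeWord x y z s' l' = w' at *
  match w, w' with
  | [], w' => simp
  | a :: w, [] => simp
  | a :: w, b :: w' =>
    simp only [List.map_cons, List.isChain_cons_cons] at h1 h2
    have key : ∀ s s' i j : Bool, s ≠ s' → s ≠ i → s' ≠ j → i ≠ j := by decide
    have hab : a.1 ≠ b.1 := key _ _ _ _ hs h1.1 h2.1
    rw [LetterMetric.listDist_cons_of_ne _ fun e => hab (congrArg Sigma.fst e),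
      lengthMetric_dist_of_ne hab]
    simp; omega

end IsPivot

/-- An amalgamated product is quasi-isometric to a set of lists with letters in the set of
nontrivial coset representatives, three of which are replaced by two bits. -/
theorem IsAmalgam.isCoarseEquivalence {Q : Type*} [Group Q] {F : ∀ i, Subgroup (G i)}
    {e : ∀ i, G i →* Q} {N : Q → ℕ} (hQ : IsAmalgam F e) (hN : IsFactorLength ℓ e N)
    (hτ : ∀ i, IsTransversal (F i) (τ i)) (hℓ : ∀ i, IsLength (ℓ i))
    {c : ℕ} (hc : ∀ i, ∀ f ∈ F i, ℓ i f ≤ c) (h : IsPivot τ x y z) :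
    IsCoarseEquivalence (otherMetric ℓ τ x y z).rootedDist (fun g g' => N (g⁻¹ * g'))
      fun u => evalWord e (decodeWord x y z u.1 u.2) := by
  obtain ⟨m, hx, hy, hz⟩ : ∃ m, ℓ x.1 x.2 ≤ m ∧ ℓ y.1 y.2 ≤ m ∧ ℓ z.1 z.2 ≤ m :=
    ⟨ℓ x.1 x.2 + ℓ y.1 y.2 + ℓ z.1 z.2, by omega, by omega, by omega⟩
  have hD := h.comparable_listDist_decodeWord hℓ hx hy hz
  have hW : ∀ s l, Comparable ((m + 1) * (2 * m + 3))
      ((lengthMetric ℓ).weight (decodeWord x y z s l))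
      ((otherMetric ℓ τ x y z).withBits.weight l) := by
    intro s l
    simpa [decodeWord, encodeList] using hD s [] l
  have hA := fun u v : Bool × List (Bool ⊕ OtherLetter τ x y z) =>
    hQ.comparable_listDist hτ hℓ hc hN (h.isCosetWord_decodeWord u.1 u.2)
    (h.isCosetWord_decodeWord v.1 v.2)
  set K := (m + 1) * (2 * m + 3) with hK
  set K' := (1 + 2 * c) * (1 + c) with hK'
  have hKpos : 3 ≤ K := by nlinarith
  have hK'pos : 1 ≤ K' := by nlinarith
  have h1 : K ≤ K' * K := Nat.le_mul_of_pos_left _ hK'pos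
  refine ⟨K' * K + c + m, ?_, fun g => ?_⟩
  · rintro ⟨s, l⟩ ⟨s', l'⟩
    have h3 := hA (s, l) (s', l')
    by_cases hs : s = s'
    · subst hs
      have h2 := h3.trans (hD s l l')
      simp only [LetterMetric.rootedDist, LetterMetric.listDist_cons_self] at h2 ⊢
      exact ⟨h2.1.trans (Nat.mul_le_mul (by omega) (by omega)),
        h2.2.trans (Nat.mul_le_mul (by omega) (by omega))⟩
    · have h2 := h3
      simp only [h.listDist_decodeWord_of_ne hs] at h2
      have h4 := h2.trans ((hW s l).add (hW s' l'))
      simp only [LetterMetric.rootedDist]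
      rw [LetterMetric.listDist_cons_of_ne _ (by simpa using hs),
        LetterMetric.withBits_dist_inl_inl]
      refine ⟨h4.1.trans (Nat.mul_le_mul (by omega) (by omega)), ?_⟩
      have := h4.2
      nlinarith
  · obtain ⟨w, b, hw, hb, rfl⟩ := hQ.exists_isCosetWord hτ hℓ hc hN g
    obtain ⟨s, hs⟩ : ∃ s : Bool, (s :: w.map Sigma.fst).IsChain (· ≠ ·) := by
      match w with
      | [] => exact ⟨true, by simp⟩
      | a :: w => exact ⟨!a.1, by simpa [List.isChain_cons_cons] using hw.1⟩
    obtain ⟨l, r, rfl, hr⟩ := h.exists_decodeWord s w hs hw.2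
    refine ⟨(s, l), ?_⟩
    have h2 : (evalWord e (decodeWord x y z s l))⁻¹ *
        (evalWord e (decodeWord x y z s l ++ r) * b) = evalWord e r * b := by
      simp [mul_assoc]
    have h3 : N b ≤ c := by
      obtain ⟨f, hf, rfl⟩ := hb true
      exact (hN.map_factor_le _ _).trans (hc _ _ hf)
    have h4 : (lengthMetric ℓ).weight r ≤ m := by
      rcases hr with rfl | ⟨t, rfl⟩
      · simp
      · simpa using length_switchLetter_le hx hy t
    have h5 := hN.le_weight r
    have h6 := hN.map_mul_le (evalWord e r) b
    simp only [h2]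
    omega

end Code

/-! ### Comparing the sets of letters -/

/-- The lists of letters of one alphabet with two additional letters are coarsely equivalent to
those of another one, by a map that preserves the empty list. -/
def LetterMetric.ListsEquivalent {Y Y' : Type*} (M : LetterMetric Y) (M' : LetterMetric Y') :
    Prop :=
  ∃ K, 1 ≤ K ∧ ∃ g : List (Bool ⊕ Y) → List (Bool ⊕ Y'), g [] = [] ∧
    (∀ l l', Comparable K (M'.withBits.listDist (g l) (g l')) (M.withBits.listDist l l')) ∧
    ∀ l', ∃ l, M'.withBits.listDist (g l) l' ≤ K

namespace LetterMetric

variable {Y Y' : Type*} {M : LetterMetric Y} {M' : LetterMetric Y'}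

theorem ListsEquivalent.exists_isCoarseEquivalence (h : M.ListsEquivalent M') :
    ∃ f, IsCoarseEquivalence M.rootedDist M'.rootedDist f := by
  obtain ⟨K, hK, g, hg, hD, hd⟩ := h
  have hW : ∀ l, Comparable K (M'.withBits.weight (g l)) (M.withBits.weight l) := by
    intro l
    simpa [hg] using hD [] l
  refine ⟨fun u => (u.1, g u.2), K + 2, ?_, ?_⟩
  · rintro ⟨s, l⟩ ⟨s', l'⟩
    by_cases hs : s = s'
    · subst hs
      simp only [rootedDist, listDist_cons_self]
      exact ⟨(hD l l').1.trans (Nat.mul_le_mul (by omega) (by omega)),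
        (hD l l').2.trans (Nat.mul_le_mul (by omega) (by omega))⟩
    · have h1 := (hW l).add (hW l')
      have hs' : (.inl s : Bool ⊕ Y) ≠ .inl s' := by simpa using hs
      have hs'' : (.inl s : Bool ⊕ Y') ≠ .inl s' := by simpa using hs
      simp only [rootedDist]
      rw [listDist_cons_of_ne _ hs', listDist_cons_of_ne _ hs'', withBits_dist_inl_inl,
        withBits_dist_inl_inl]
      have := h1.1
      have := h1.2
      constructor <;> nlinarith
  · rintro ⟨s, l'⟩
    obtain ⟨l, hl⟩ := hd l'
    refine ⟨(s, l), ?_⟩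
    simp only [rootedDist, listDist_cons_self]
    omega

theorem listDist_self (M : LetterMetric Y) (l : List Y) : M.listDist l l = 0 := by
  simpa using M.listDist_append_left l [] []

/-- A single additional letter is redundant. -/
theorem exists_comparable_of_unit (M : LetterMetric Unit) (hM : M.size () = 1)
    (M' : LetterMetric Y') :
    ∃ K, 1 ≤ K ∧ ∃ g : List (Bool ⊕ Unit) → List (Bool ⊕ Y'), g [] = [] ∧
      (∀ l l', Comparable K (M'.withBits.listDist (g l) (g l')) (M.withBits.listDist l l')) ∧
      ∀ h : List Bool, ∃ l, M'.withBits.listDist (g l) (h.map .inl) ≤ 1 := by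
  let emit : Unit → Bool ⊕ Unit → List (Bool ⊕ Y') := fun _ σ => match σ with
    | .inl false => [.inl false]
    | .inl true => [.inl true, .inl false]
    | .inr _ => [.inl true, .inl true]
  refine ⟨4, by omega, fun l => encodeList emit (fun _ _ => ()) () l, rfl,
    fun l l' => M.withBits.comparable_listDist_encodeList M'.withBits ?_ ?_ ?_ () l l', ?_⟩
  · rintro - ((_ | _) | _) <;> simp [emit, Comparable, hM]
  · rintro - ((_ | _) | _) ((_ | _) | _) hab <;>
      simp [emit, Comparable, listDist_cons_of_ne, hM] at hab ⊢
  · rintro - ((_ | _) | _) ((_ | _) | _) hab <;> simp [emit] at hab ⊢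
  · have key : ∀ n, ∀ h : List Bool, h.length ≤ n → ∃ l r,
        h.map (Sum.inl : Bool → Bool ⊕ Y') = encodeList emit (fun _ _ => ()) () l ++ r ∧
        (r = [] ∨ r = [.inl true]) := by
      intro n
      induction n with
      | zero =>
        intro h hh
        rw [List.length_eq_zero_iff.1 (Nat.le_zero.1 hh)]
        exact ⟨[], [], rfl, Or.inl rfl⟩
      | succ n ih =>
        intro h hh
        match h with
        | [] => exact ⟨[], [], rfl, Or.inl rfl⟩
        | [true] => exact ⟨[], [.inl true], rfl, Or.inr rfl⟩
        | false :: h =>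
          obtain ⟨l, r, e, hr⟩ := ih h (by simpa using hh)
          exact ⟨.inl false :: l, r, by simp [encodeList, emit, e], hr⟩
        | true :: false :: h =>
          obtain ⟨l, r, e, hr⟩ := ih h (by simp at hh; omega)
          exact ⟨.inl true :: l, r, by simp [encodeList, emit, e], hr⟩
        | true :: true :: h =>
          obtain ⟨l, r, e, hr⟩ := ih h (by simp at hh; omega)
          exact ⟨.inr () :: l, r, by simp [encodeList, emit, e], hr⟩
    intro h
    obtain ⟨l, r, e, hr⟩ := key _ h le_rfl
    refine ⟨l, ?_⟩
    rw [e]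
    have := M'.withBits.listDist_append_left (encodeList emit (fun _ _ => ()) () l) [] r
    rw [List.append_nil] at this
    rw [this]
    rcases hr with rfl | rfl <;> simp

end LetterMetric

section Letters

variable {G : Bool → Type*} [∀ i, Group (G i)] {F : ∀ i, Subgroup (G i)} {ℓ : ∀ i, G i → ℕ}
  {τ : ∀ i, G i → G i} {x y z : Σ i, G i}

theorem isTransversal_bot {H : Type*} [Group H] : IsTransversal (⊥ : Subgroup H) id :=
  ⟨rfl, by simp, fun g h hgh => by simpa [inv_mul_eq_one] using hgh⟩

/-- The representative of the coset of a letter. -/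
def cosetRep (τ : ∀ i, G i → G i) (a : Σ i, G i) : Σ i, G i := ⟨a.1, τ a.1 a.2⟩

/-- The position of a letter in its coset. -/
def cosetIndex (hτ : ∀ i, IsTransversal (F i) (τ i)) (a : Σ i, G i) : Σ i, F i :=
  ⟨a.1, (τ a.1 a.2)⁻¹ * a.2, (hτ a.1).mem a.2⟩

theorem eq_of_cosetRep_eq (hτ : ∀ i, IsTransversal (F i) (τ i)) {a b : Σ i, G i}
    (h : cosetRep τ a = cosetRep τ b) (h' : cosetIndex hτ a = cosetIndex hτ b) : a = b := by
  obtain ⟨i, g⟩ := a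
  obtain ⟨j, g'⟩ := b
  obtain rfl : i = j := congrArg Sigma.fst h
  simp only [cosetRep, cosetIndex, Sigma.mk.injEq, heq_eq_eq, true_and, Subtype.mk.injEq] at h h'
  rw [h] at h'
  rw [mul_left_cancel h']

theorem dist_cosetRep_le (hτ : ∀ i, IsTransversal (F i) (τ i)) (hℓ : ∀ i, IsLength (ℓ i))
    {c : ℕ} (hc : ∀ i, ∀ f ∈ F i, ℓ i f ≤ c) (a : Σ i, G i) :
    (lengthMetric ℓ).dist a (cosetRep τ a) ≤ c := by
  obtain ⟨i, g⟩ := a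
  rw [cosetRep, lengthMetric_dist_same, ← (hℓ i).map_inv]
  exact hc _ _ (by simpa using (hτ i).mem g)

/-- The representatives that are not used as letters. -/
def exceptionalLetters (x y z : Σ i, G i) : Set (Σ i, G i) :=
  {⟨true, 1⟩, ⟨false, 1⟩, x, y, z}

theorem finite_exceptionalLetters : (exceptionalLetters x y z).Finite := by
  unfold exceptionalLetters
  exact Set.toFinite _

theorem cosetRep_mem_or (hτ : ∀ i, IsTransversal (F i) (τ i)) (a : Σ i, G i) :
    cosetRep τ a ∈ exceptionalLetters x y z ∨
      (IsCosetLetter τ (cosetRep τ a) ∧ cosetRep τ a ≠ x ∧ cosetRep τ a ≠ y ∧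
        cosetRep τ a ≠ z) := by
  by_cases h1 : τ a.1 a.2 = 1
  · left
    have : cosetRep τ a = ⟨a.1, 1⟩ := by rw [cosetRep, h1]
    rw [this]
    cases a.1 <;> simp [exceptionalLetters]
  · by_cases h : cosetRep τ a ∈ exceptionalLetters x y z
    · exact Or.inl h
    · refine Or.inr ⟨⟨(hτ _).map_map _, h1⟩, ?_, ?_, ?_⟩ <;> rintro h' <;>
        exact h (by simp [exceptionalLetters, h'])

theorem IsPivot.id (h : IsPivot τ x y z) : IsPivot (fun i => (_root_.id : G i → G i)) x y z :=
  ⟨⟨rfl, h.left.2⟩, ⟨rfl, h.right.2⟩, ⟨rfl, h.right'.2⟩, h.fst_ne, h.fst_eq, h.ne⟩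

/-- Replacing the letters by coset representatives does not change the coarse geometry of the
set of lists. -/
theorem listsEquivalent_otherMetric [∀ i, Finite (F i)] (hτ : ∀ i, IsTransversal (F i) (τ i))
    (hℓ : ∀ i, IsLength (ℓ i)) {c : ℕ} (hc : ∀ i, ∀ f ∈ F i, ℓ i f ≤ c) (x y z : Σ i, G i) :
    (otherMetric ℓ (fun i => (_root_.id : G i → G i)) x y z).ListsEquivalent
      (otherMetric ℓ τ x y z) := by
  classical
  set M := otherMetric ℓ (fun i => (_root_.id : G i → G i)) x y z with hM
  have hpos : ∀ a, 1 ≤ M.size a := fun a => (hℓ _).pos a.2.1.2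
  have hdpos : ∀ a b, a ≠ b → 1 ≤ M.dist a b := fun a b hab =>
    lengthMetric_dist_pos hℓ (Subtype.coe_injective.ne hab) b.2.1.2
  have hdle : ∀ a b, M.dist a b ≤ M.size a + M.size b := fun a b => lengthMetric_dist_le hℓ _ _
  have : Finite (exceptionalLetters x y z) := finite_exceptionalLetters
  obtain ⟨m, hm⟩ : ∃ m, ∀ a ∈ exceptionalLetters x y z, ℓ a.1 a.2 ≤ m := by
    obtain ⟨m, hm⟩ := (finite_exceptionalLetters.image fun a : Σ i, G i => ℓ a.1 a.2).bddAbove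
    exact ⟨m, fun a ha => hm ⟨a, ha, rfl⟩⟩
  have hm' : ∀ a : Σ i, G i, cosetRep τ a ∈ exceptionalLetters x y z → ℓ a.1 a.2 ≤ m + c := by
    intro a ha
    have := hm _ ha
    have := lengthMetric_size_le hℓ a (cosetRep τ a)
    have := dist_cosetRep_le hτ hℓ hc a
    omega
  rcases isEmpty_or_nonempty (OtherLetter τ x y z) with hY | ⟨⟨y₀⟩⟩
  · have hrep : ∀ a : Σ i, G i, cosetRep τ a ∈ exceptionalLetters x y z := fun a =>
      (cosetRep_mem_or hτ a).resolve_right fun h => hY.false ⟨_, h⟩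
    have : Finite (OtherLetter (fun i => (_root_.id : G i → G i)) x y z) := by
      refine Finite.of_injective
        (fun a => (cosetIndex hτ a.1, (⟨_, hrep a.1⟩ : exceptionalLetters x y z))) ?_
      intro a b hab
      simp only [Prod.mk.injEq, Subtype.mk.injEq] at hab
      exact Subtype.ext (eq_of_cosetRep_eq hτ hab.2 hab.1)
    rcases isEmpty_or_nonempty (OtherLetter (fun i => (_root_.id : G i → G i)) x y z) with hY' | hY'
    · obtain ⟨K, hK, g, hg, hg', hD⟩ := M.exists_surjective_comparable_of_finite_fibers
        (otherMetric ℓ τ x y z) (fun a => isEmptyElim a) (fun b => isEmptyElim b) _root_.id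
        (fun a => isEmptyElim a) le_rfl hpos hdpos (fun a => isEmptyElim a)
        (fun a => isEmptyElim a) (fun a => isEmptyElim a)
      refine ⟨K, hK, g, hg', hD, fun l' => ?_⟩
      obtain ⟨l, rfl⟩ := hg l'
      exact ⟨l, by simp [LetterMetric.listDist_self]⟩
    · have hsize : ∀ a, Comparable (2 * (m + c) + 1) 1 (M.size a) := by
        intro a
        have := hm' a.1 (hrep _)
        have := hpos a
        have : M.size a = ℓ a.1.1 a.1.2 := rfl
        exact Comparable.mono (K := m + c + 1) (by omega)
          (.of_le_add le_rfl (hpos a) (by omega) (by omega))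
      have hfiber : ∀ a b, M.dist a b ≤ 2 * (m + c) + 1 := by
        intro a b
        have := hm' a.1 (hrep _)
        have := hm' b.1 (hrep _)
        have : M.dist a b ≤ ℓ a.1.1 a.1.2 + ℓ b.1.1 b.1.2 := hdle a b
        omega
      obtain ⟨K, hK, g, hg, hg', hD⟩ := M.exists_surjective_comparable_of_finite_fibers
        (⟨fun _ => 1, fun _ _ => 0⟩ : LetterMetric Unit) (fun _ => ())
        (fun _ => ⟨hY'.some, rfl⟩) _root_.id (fun _ _ _ h => h) (by omega)
        hpos hdpos hsize (fun a b h => absurd rfl h) (fun a b _ => hfiber a b)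
      obtain ⟨K', hK', g', hg0, hD', hd⟩ := LetterMetric.exists_comparable_of_unit
        (⟨fun _ => 1, fun _ _ => 0⟩ : LetterMetric Unit) rfl
        (otherMetric ℓ τ x y z)
      refine ⟨K' * K, Nat.mul_pos hK' hK, g' ∘ g, by simp [hg', hg0], fun l l' =>
        (hD' _ _).trans (hD l l'), fun l' => ?_⟩
      obtain ⟨h, rfl⟩ : ∃ h : List Bool, l' = h.map .inl :=
        ⟨l'.map (Sum.elim _root_.id fun a => (hY.false a).elim), by
          rw [List.map_map]
          refine (List.map_id'' ?_ _).symm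
          rintro (a | a)
          · rfl
          · exact (hY.false a).elim⟩
      obtain ⟨l, hl⟩ := hd h
      obtain ⟨l₁, rfl⟩ := hg l
      exact ⟨l₁, hl.trans (Nat.mul_pos hK' hK)⟩
  · let good : (Σ i, G i) → Prop := fun a => IsCosetLetter τ a ∧ a ≠ x ∧ a ≠ y ∧ a ≠ z
    let π : OtherLetter (fun i => (_root_.id : G i → G i)) x y z → OtherLetter τ x y z := fun a =>
      if h : good (cosetRep τ a.1) then ⟨_, h⟩ else y₀
    let E : Set (Σ i, G i) := insert y₀.1 (exceptionalLetters x y z)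
    have : Finite E := finite_exceptionalLetters.insert _
    let q : OtherLetter (fun i => (_root_.id : G i → G i)) x y z → E := fun a =>
      if h : good (cosetRep τ a.1) then ⟨y₀.1, Or.inl rfl⟩
      else ⟨cosetRep τ a.1, Or.inr ((cosetRep_mem_or hτ a.1).resolve_right h)⟩
    have hπ : Function.Surjective π := by
      intro b
      refine ⟨⟨b.1, ⟨rfl, b.2.1.2⟩, b.2.2⟩, ?_⟩
      have hb : cosetRep τ b.1 = b.1 := by
        obtain ⟨⟨i, g⟩, hb⟩ := b
        exact Sigma.ext rfl (heq_of_eq hb.1.1)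
      simp only [π, hb]
      rw [dif_pos b.2]
    have hlabel : ∀ a b, π a = π b → (cosetIndex hτ a.1, q a) = (cosetIndex hτ b.1, q b) →
        a = b := by
      intro a b h1 h2
      simp only [Prod.mk.injEq] at h2
      refine Subtype.ext (eq_of_cosetRep_eq hτ ?_ h2.1)
      have h3 := h2.2
      by_cases ha : good (cosetRep τ a.1) <;> by_cases hb : good (cosetRep τ b.1) <;>
        simp only [π, q, ha, hb, dif_pos, dif_neg, not_false_eq_true, Subtype.ext_iff] at h1 h3
      · exact h1
      · exact h1.trans h3
      · exact h3.trans h1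
      · exact h3
    obtain ⟨C, hC⟩ : ∃ C, ∀ a, (lengthMetric ℓ).dist a.1 (π a).1 ≤ C := by
      refine ⟨m + c + ℓ y₀.1.1 y₀.1.2, fun a => ?_⟩
      by_cases ha : good (cosetRep τ a.1)
      · simp only [π, ha, dif_pos]
        have := dist_cosetRep_le hτ hℓ hc a.1
        omega
      · simp only [π, ha, dif_neg, not_false_eq_true]
        have := hm' a.1 ((cosetRep_mem_or hτ a.1).resolve_right ha)
        have := lengthMetric_dist_le hℓ a.1 y₀.1
        omega
    have hC' : ∀ a, (lengthMetric ℓ).dist (π a).1 a.1 ≤ C := fun a => by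
      rw [lengthMetric_dist_comm hℓ]
      exact hC a
    have hsize : ∀ a, Comparable (2 * C + 1) ((otherMetric ℓ τ x y z).size (π a)) (M.size a) := by
      intro a
      have h1 := lengthMetric_size_le hℓ a.1 (π a).1
      have h2 := lengthMetric_size_le hℓ (π a).1 a.1
      have h3 := hC a
      have h4 := hC' a
      have h5 : M.size a = ℓ a.1.1 a.1.2 := rfl
      have h6 : (otherMetric ℓ τ x y z).size (π a) = ℓ (π a).1.1 (π a).1.2 := rfl
      exact .of_le_add ((hℓ _).pos (π a).2.1.2) (hpos a) (by omega) (by omega)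
    have hdist : ∀ a b, π a ≠ π b →
        Comparable (2 * C + 1) ((otherMetric ℓ τ x y z).dist (π a) (π b)) (M.dist a b) := by
      intro a b hab
      have h1 := lengthMetric_triangle hℓ a.1 (π a).1 b.1
      have h2 := lengthMetric_triangle hℓ (π a).1 (π b).1 b.1
      have h3 := lengthMetric_triangle hℓ (π a).1 a.1 (π b).1
      have h4 := lengthMetric_triangle hℓ a.1 b.1 (π b).1
      have h5 : M.dist a b = (lengthMetric ℓ).dist a.1 b.1 := rfl
      have h6 : (otherMetric ℓ τ x y z).dist (π a) (π b) =
        (lengthMetric ℓ).dist (π a).1 (π b).1 := rfl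
      have := hC a
      have := hC' a
      have := hC b
      have := hC' b
      exact .of_le_add (lengthMetric_dist_pos hℓ (Subtype.coe_injective.ne hab) (π b).2.1.2)
        (hdpos a b fun h => hab (congrArg π h)) (by omega) (by omega)
    have hfiber : ∀ a b, π a = π b → M.dist a b ≤ 2 * C + 1 := by
      intro a b hab
      have h1 := lengthMetric_triangle hℓ a.1 (π a).1 b.1
      have h5 : M.dist a b = (lengthMetric ℓ).dist a.1 b.1 := rfl
      have h2 := hC a
      have := hC' b
      rw [hab] at h1 h2
      omega
    obtain ⟨K, hK, g, hg, hg', hD⟩ := M.exists_surjective_comparable_of_finite_fibers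
      (otherMetric ℓ τ x y z) π hπ (fun a => (cosetIndex hτ a.1, q a)) hlabel (by omega) hpos
      hdpos hsize hdist hfiber
    refine ⟨K, hK, g, hg', hD, fun l' => ?_⟩
    obtain ⟨l, rfl⟩ := hg l'
    exact ⟨l, by simp [LetterMetric.listDist_self]⟩

end Letters

/-! ### Amalgamated products with the same factors -/

namespace IsCoarseEquivalence

variable {X Y Z : Type*} {dX : X → X → ℕ} {dY : Y → Y → ℕ} {dZ : Z → Z → ℕ}

theorem comp {f : X → Y} {g : Y → Z} (hg : IsCoarseEquivalence dY dZ g)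
    (hf : IsCoarseEquivalence dX dY f) (tri : ∀ a b c, dZ a c ≤ dZ a b + dZ b c) :
    IsCoarseEquivalence dX dZ (g ∘ f) := by
  obtain ⟨K, hK, hK'⟩ := hf
  obtain ⟨L, hL, hL'⟩ := hg
  refine ⟨L * (K + 1) + K * (L + 1) + L, fun a b => ⟨?_, ?_⟩, fun c => ?_⟩
  · have h1 := (hL (f a) (f b)).1
    have h2 := Nat.mul_le_mul_left L (Nat.succ_le_succ (hK a b).1)
    simp only [Function.comp_apply]
    nlinarith [Nat.zero_le (K * L * dX a b), Nat.zero_le (K * dX a b), Nat.zero_le (L * dX a b)]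
  · have h1 := (hK a b).2
    have h2 := Nat.mul_le_mul_left K (Nat.succ_le_succ (hL (f a) (f b)).2)
    simp only [Function.comp_apply]
    nlinarith [Nat.zero_le (K * L * dZ (g (f a)) (g (f b))),
      Nat.zero_le (K * dZ (g (f a)) (g (f b))), Nat.zero_le (L * dZ (g (f a)) (g (f b)))]
  · obtain ⟨b, hb⟩ := hL' c
    obtain ⟨a, ha⟩ := hK' b
    refine ⟨a, ?_⟩
    have h1 := tri (g (f a)) (g b) c
    have h2 := (hL (f a) b).1
    have h3 := Nat.mul_le_mul_left L (Nat.succ_le_succ ha)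
    simp only [Function.comp_apply]
    nlinarith

/-- A coarse equivalence has a quasi-inverse. -/
theorem exists_inverse {f : X → Y} (hf : IsCoarseEquivalence dX dY f)
    (symm : ∀ a b, dY a b = dY b a) (tri : ∀ a b c, dY a c ≤ dY a b + dY b c) :
    ∃ s, IsCoarseEquivalence dY dX s := by
  obtain ⟨K, hK, hK'⟩ := hf
  choose s hs using hK'
  refine ⟨s, K * (2 * K + 2) + 2 * K + 1, fun a b => ⟨?_, ?_⟩, fun c => ⟨f c, ?_⟩⟩
  · have h1 := (hK (s a) (s b)).2
    have h2 := tri (f (s a)) a (f (s b))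
    have h3 := tri a b (f (s b))
    have h4 := hs a
    have h5 := hs b
    rw [symm] at h5
    have h6 := Nat.mul_le_mul_left K (Nat.succ_le_succ (h2.trans (Nat.add_le_add h4
      (h3.trans (Nat.add_le_add_left h5 _)))))
    nlinarith [Nat.zero_le (K * K * dY a b), Nat.zero_le (K * dY a b)]
  · have h1 := (hK (s a) (s b)).1
    have h2 := tri a (f (s a)) b
    have h3 := tri (f (s a)) (f (s b)) b
    have h4 := hs a
    have h5 := hs b
    rw [symm] at h4
    nlinarith [Nat.zero_le (K * K * dX (s a) (s b)), Nat.zero_le (K * dX (s a) (s b))]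
  · have h1 := (hK (s (f c)) c).2
    have h2 := Nat.mul_le_mul_left K (Nat.succ_le_succ (hs (f c)))
    nlinarith

end IsCoarseEquivalence

section

variable {G : Bool → Type*} [∀ i, Group (G i)] {F : ∀ i, Subgroup (G i)} {ℓ : ∀ i, G i → ℕ}

theorem IsFactorLength.symm {Q : Type*} [Group Q] {e : ∀ i, G i →* Q} {N : Q → ℕ}
    (hN : IsFactorLength ℓ e N) (a b : Q) : N (a⁻¹ * b) = N (b⁻¹ * a) := by
  rw [← hN.map_inv]
  simp

theorem IsFactorLength.triangle {Q : Type*} [Group Q] {e : ∀ i, G i →* Q} {N : Q → ℕ}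
    (hN : IsFactorLength ℓ e N) (a b c : Q) : N (a⁻¹ * c) ≤ N (a⁻¹ * b) + N (b⁻¹ * c) := by
  simpa [mul_assoc] using hN.map_mul_le (a⁻¹ * b) (b⁻¹ * c)

theorem exists_isTransversal {H : Type*} [Group H] (F : Subgroup H) :
    ∃ τ : H → H, IsTransversal F τ := by
  classical
  refine ⟨fun g => if g ∈ F then 1 else (g : H ⧸ F).out, by simp, fun g => ?_, fun g h hgh => ?_⟩
  · split_ifs with hg
    · simpa using hg
    · exact QuotientGroup.eq.1 (QuotientGroup.out_eq' _)
  · have h1 : g ∈ F ↔ h ∈ F := by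
      constructor <;> intro h2
      · simpa using F.mul_mem h2 hgh
      · simpa using F.mul_mem h2 (F.inv_mem hgh)
    have h2 : (g : H ⧸ F) = h := QuotientGroup.eq.2 hgh
    simp only [h1, h2]

theorem exists_not_mem_of_index_ne_two {H : Type*} [Group H] {F : Subgroup H} (hF : F ≠ ⊤)
    (hF' : F.index ≠ 2) : ∃ g h, g ∉ F ∧ h ∉ F ∧ g⁻¹ * h ∉ F := by
  obtain ⟨g, hg⟩ : ∃ g, g ∉ F := by
    by_contra! h
    exact hF (eq_top_iff.2 fun g _ => h g)
  by_contra! h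
  refine hF' (Subgroup.index_eq_two_iff.2 ⟨g, fun b => ?_⟩)
  by_cases hb : b ∈ F
  · exact Or.inr ⟨hb, fun h' => hg (by simpa using F.mul_mem (F.inv_mem hb) h')⟩
  · refine Or.inl ⟨?_, hb⟩
    have := F.inv_mem (h g b⁻¹ hg (by simpa using hb))
    simpa using this

theorem exists_isPivot {τ : ∀ i, G i → G i} (hτ : ∀ i, IsTransversal (F i) (τ i))
    (hF : ∀ i, F i ≠ ⊤) {i : Bool} (hi : (F i).index ≠ 2) : ∃ x y z, IsPivot τ x y z := by
  obtain ⟨g, h, hg, hh, hgh⟩ := exists_not_mem_of_index_ne_two (hF i) hi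
  obtain ⟨k, hk⟩ : ∃ k, k ∉ F (!i) := by
    by_contra! h
    exact hF _ (eq_top_iff.2 fun g _ => h g)
  have key : ∀ j, ∀ g ∉ F j, IsCosetLetter τ ⟨j, τ j g⟩ := fun j g hg =>
    ⟨(hτ j).map_map g, fun h => hg ((hτ j).mem_of_eq_one h)⟩
  refine ⟨⟨!i, τ _ k⟩, ⟨i, τ _ g⟩, ⟨i, τ _ h⟩, key _ _ hk, key _ _ hg, key _ _ hh, by simp, rfl,
    fun e => hgh ?_⟩
  have e' : τ i g = τ i h := by simpa using e
  have := (F i).mul_mem ((F i).inv_mem ((hτ i).mem g)) ((hτ i).mem h)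
  simpa [e', mul_assoc] using this

/-- The coarse geometry of an amalgamated product with finite amalgamated subgroup depends only on
the factors, provided that the subgroup is not of index two in both factors. -/
theorem IsAmalgam.exists_isCoarseEquivalence [∀ i, Finite (F i)] {Q Q' : Type*} [Group Q]
    [Group Q'] {e : ∀ i, G i →* Q} {e' : ∀ i, G i →* Q'} {N : Q → ℕ} {N' : Q' → ℕ}
    (hQ : IsAmalgam (fun i => (⊥ : Subgroup (G i))) e) (hQ' : IsAmalgam F e')
    (hN : IsFactorLength ℓ e N) (hN' : IsFactorLength ℓ e' N') (hℓ : ∀ i, IsLength (ℓ i))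
    (hF : ∀ i, F i ≠ ⊤) {i : Bool} (hi : (F i).index ≠ 2) :
    ∃ f, IsCoarseEquivalence (fun g g' => N (g⁻¹ * g')) (fun g g' => N' (g⁻¹ * g')) f := by
  choose τ hτ using fun i => exists_isTransversal (F i)
  obtain ⟨x, y, z, h⟩ := exists_isPivot hτ hF hi
  obtain ⟨c, hc⟩ : ∃ c, ∀ i, ∀ f ∈ F i, ℓ i f ≤ c := by
    obtain ⟨c, hc⟩ := (Set.finite_range fun p : Σ i, F i => ℓ p.1 p.2).bddAbove
    exact ⟨c, fun i f hf => hc ⟨⟨i, f, hf⟩, rfl⟩⟩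
  have h1 := hQ.isCoarseEquivalence hN (fun i => isTransversal_bot) hℓ (c := 0)
    (fun i f hf => by rw [Subgroup.mem_bot.1 hf, (hℓ i).map_one]) h.id
  have h2 := hQ'.isCoarseEquivalence hN' hτ hℓ hc h
  obtain ⟨g, hg⟩ := (listsEquivalent_otherMetric hτ hℓ hc x y z).exists_isCoarseEquivalence
  obtain ⟨s, hs⟩ := h1.exists_inverse hN.symm hN.triangle
  exact ⟨_, (h2.comp hg hN'.triangle).comp hs hN'.triangle⟩

end

/-! ### Word lengths and normal forms -/

section WordDist

variable {H : Type*} [Group H] {S : Set H}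

theorem wordDist_eq (S : Set H) (g h : H) : wordDist S g h = wordDist S 1 (g⁻¹ * h) := by
  simp [wordDist]

theorem wordDist_one_le {l : List H} (hl : ∀ x ∈ l, x ∈ S ∨ x⁻¹ ∈ S) :
    wordDist S 1 l.prod ≤ l.length :=
  Nat.sInf_le ⟨l, rfl, hl, by simp⟩

theorem exists_prod_eq_of_closure_eq_top (hS : Subgroup.closure S = ⊤) (g : H) :
    ∃ l : List H, l.length = wordDist S 1 g ∧ (∀ x ∈ l, x ∈ S ∨ x⁻¹ ∈ S) ∧ l.prod = g := by
  have h : g ∈ (Subgroup.closure S).toSubmonoid := by simp [hS]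
  rw [Subgroup.closure_toSubmonoid] at h
  obtain ⟨l, hl, hg⟩ := Submonoid.exists_list_of_mem_closure h
  have : wordDist S 1 g ∈
      {n | ∃ l : List H, l.length = n ∧ (∀ x ∈ l, x ∈ S ∨ x⁻¹ ∈ S) ∧ l.prod = 1⁻¹ * g} :=
    Nat.sInf_mem ⟨l.length, l, rfl, hl, by simpa using hg⟩
  simpa using this

theorem isLength_wordDist (hS : Subgroup.closure S = ⊤) : IsLength (wordDist S 1) where
  map_one := by simpa using wordDist_one_le (S := S) (l := []) (by simp)
  eq_one g hg := by
    obtain ⟨l, h1, -, h3⟩ := exists_prod_eq_of_closure_eq_top hS g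
    rw [hg, List.length_eq_zero_iff] at h1
    simpa [h1] using h3.symm
  map_mul_le g h := by
    obtain ⟨l, h1, h2, rfl⟩ := exists_prod_eq_of_closure_eq_top hS g
    obtain ⟨l', h1', h2', rfl⟩ := exists_prod_eq_of_closure_eq_top hS h
    rw [← h1, ← h1', ← List.prod_append, ← List.length_append]
    refine wordDist_one_le fun x hx => ?_
    rcases List.mem_append.1 hx with hx | hx
    exacts [h2 x hx, h2' x hx]
  map_inv := by
    have key : ∀ g, wordDist S 1 g⁻¹ ≤ wordDist S 1 g := by
      intro g
      obtain ⟨l, h1, h2, rfl⟩ := exists_prod_eq_of_closure_eq_top hS g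
      rw [← h1, List.prod_inv_reverse]
      refine (wordDist_one_le fun x hx => ?_).trans (by simp)
      simp only [List.mem_reverse, List.mem_map] at hx
      obtain ⟨y, hy, rfl⟩ := hx
      rw [inv_inv]
      exact (h2 y hy).symm
    exact fun g => le_antisymm (key g) (by simpa using key g⁻¹)

end WordDist

section

variable {G : Bool → Type*} [∀ i, Group (G i)] {Q : Type*} [Group Q]

theorem isFactorLength_wordDist {S : ∀ i, Set (G i)} (hS : ∀ i, Subgroup.closure (S i) = ⊤)
    {e : ∀ i, G i →* Q} (hT : Subgroup.closure (⋃ i, e i '' S i) = ⊤) :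
    IsFactorLength (fun i => wordDist (S i) 1) e (wordDist (⋃ i, e i '' S i) 1) where
  map_one := (isLength_wordDist hT).map_one
  map_mul_le := (isLength_wordDist hT).map_mul_le
  map_inv := (isLength_wordDist hT).map_inv
  map_factor_le i g := by
    obtain ⟨l, h1, h2, rfl⟩ := exists_prod_eq_of_closure_eq_top (hS i) g
    rw [← h1, map_list_prod]
    refine (wordDist_one_le fun x hx => ?_).trans (by simp)
    obtain ⟨y, hy, rfl⟩ := List.mem_map.1 hx
    rcases h2 y hy with h | h
    · exact Or.inl (Set.mem_iUnion.2 ⟨i, y, h, rfl⟩)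
    · exact Or.inr (Set.mem_iUnion.2 ⟨i, y⁻¹, h, map_inv _ _⟩)
  exists_word x := by
    obtain ⟨l, h1, h2, rfl⟩ := exists_prod_eq_of_closure_eq_top hT x
    rw [← h1]
    clear h1
    induction l with
    | nil => exact ⟨[], by simp⟩
    | cons a l ih =>
      obtain ⟨w, hw, hw', hw''⟩ := ih fun x hx => h2 x (List.mem_cons_of_mem _ hx)
      obtain ⟨b, hb, rfl⟩ : ∃ b : Σ i, G i, wordDist (S b.1) 1 b.2 ≤ 1 ∧ e b.1 b.2 = a := by
        rcases h2 a List.mem_cons_self with h | h <;>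
          obtain ⟨i, s, hs, hsa⟩ := Set.mem_iUnion.1 h
        · exact ⟨⟨i, s⟩, by simpa using wordDist_one_le (S := S i) (l := [s]) (by simp [hs]), hsa⟩
        · refine ⟨⟨i, s⁻¹⟩, ?_, by simp [hsa]⟩
          simpa using wordDist_one_le (S := S i) (l := [s⁻¹]) (by simp [hs])
      refine ⟨b :: w, by simp [hw], ?_, by simpa using hw''⟩
      intro c hc
      rcases List.mem_cons.1 hc with rfl | hc
      exacts [hb, hw' c hc]

theorem closure_iUnion_image_eq_top {S : ∀ i, Set (G i)} (hS : ∀ i, Subgroup.closure (S i) = ⊤)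
    {e : ∀ i, G i →* Q} (he : ⨆ i, (e i).range = ⊤) :
    Subgroup.closure (⋃ i, e i '' S i) = ⊤ := by
  rw [Subgroup.closure_iUnion, ← he]
  congr 1
  ext1 i
  rw [← MonoidHom.map_closure, hS, MonoidHom.range_eq_map]

/-- The normal form theorem for a group that maps to a pushout. -/
theorem IsAmalgam.of_pushout {H : Type*} [Group H] {φ : ∀ i, H →* G i}
    (hφ : ∀ i, Function.Injective (φ i)) {e : ∀ i, G i →* Q}
    (he : ∀ i j h, e i (φ i h) = e j (φ j h)) (Ψ : Q →* Monoid.PushoutI φ)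
    (hΨ : ∀ i g, Ψ (e i g) = Monoid.PushoutI.of i g) :
    IsAmalgam (fun i => (φ i).range) e where
  exists_eq := by
    rintro i j _ ⟨h, rfl⟩
    exact ⟨φ j h, ⟨h, rfl⟩, he j i h⟩
  eq_nil w hw hw1 := by
    have hne : ∀ a ∈ w, a.2 ≠ 1 := fun a ha h => hw.2 a ha (h ▸ one_mem _)
    let W : Monoid.CoprodI.Word G := ⟨w, hne, (List.isChain_map _).1 hw.1⟩
    have hW : Monoid.PushoutI.Reduced φ W := hw.2
    have hev : ∀ u : List (Σ i, G i), Monoid.PushoutI.ofCoprodI (φ := φ)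
        (u.map fun a => Monoid.CoprodI.of a.2).prod = Ψ (evalWord e u) := by
      intro u
      induction u with
      | nil => simp
      | cons a u ih => simp [ih, hΨ]
    have := hW.eq_empty_of_mem_range hφ (by
      rw [Monoid.CoprodI.Word.prod, hev, hw1, map_one]
      exact one_mem _)
    exact congrArg Monoid.CoprodI.Word.toList this

end

section Factors

variable (A B : Type) [Group A] [Group B]

/-- Two groups as a family. -/
def Factor : Bool → Type
  | true => A
  | false => B

instance : ∀ i, Group (Factor A B i)
  | true => inferInstanceAs (Group A)
  | false => inferInstanceAs (Group B)

variable {A B} {Q : Type*} [Group Q]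

/-- A family of homomorphisms from two groups. -/
def Factor.hom (f : A →* Q) (g : B →* Q) : ∀ i, Factor A B i →* Q
  | true => f
  | false => g

/-- A family of homomorphisms to two groups. -/
def Factor.homTo (f : Q →* A) (g : Q →* B) : ∀ i, Q →* Factor A B i
  | true => f
  | false => g

theorem Factor.iSup_range_hom (f : A →* Q) (g : B →* Q) :
    ⨆ i, (Factor.hom f g i).range = f.range ⊔ g.range := by
  rw [iSup_bool_eq]
  rfl

theorem isAmalgam_coprod :
    IsAmalgam (fun i => (⊥ : Subgroup (Factor A B i)))
      (Factor.hom (Monoid.Coprod.inl : A →* Monoid.Coprod A B) Monoid.Coprod.inr) := by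
  have := IsAmalgam.of_pushout (φ := fun i => (1 : Unit →* Factor A B i))
    (fun i => Function.injective_of_subsingleton _)
    (e := Factor.hom (Monoid.Coprod.inl : A →* Monoid.Coprod A B) Monoid.Coprod.inr)
    (by simp)
    (Monoid.Coprod.lift (Monoid.PushoutI.of (φ := fun i => (1 : Unit →* Factor A B i)) true)
      (Monoid.PushoutI.of (φ := fun i => (1 : Unit →* Factor A B i)) false))
    (by
      rintro (_ | _) g
      · exact Monoid.Coprod.lift_apply_inr _ _ _
      · exact Monoid.Coprod.lift_apply_inl _ _ _)
  simpa only [MonoidHom.range_one] using this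

variable {F : Type} [Group F] (i : F →* A) (j : F →* B)

/-- The quotient map from the free product to the amalgamated free product. -/
def AmalgamatedFreeProduct.mk : Monoid.Coprod A B →* AmalgamatedFreeProduct A B F i j :=
  QuotientGroup.mk' _

theorem AmalgamatedFreeProduct.mk_surjective :
    Function.Surjective (AmalgamatedFreeProduct.mk i j) :=
  QuotientGroup.mk'_surjective _

theorem AmalgamatedFreeProduct.mk_inl_eq_mk_inr (k : F) :
    mk i j (Monoid.Coprod.inl (i k)) = mk i j (Monoid.Coprod.inr (j k)) := by
  rw [← mul_inv_eq_one, ← map_inv, ← map_mul]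
  exact (QuotientGroup.eq_one_iff _).2 (Subgroup.subset_normalClosure ⟨k, rfl⟩)

/-- The maps from the factors to the amalgamated free product. -/
def AmalgamatedFreeProduct.of : ∀ b, Factor A B b →* AmalgamatedFreeProduct A B F i j :=
  Factor.hom ((AmalgamatedFreeProduct.mk i j).comp Monoid.Coprod.inl)
    ((AmalgamatedFreeProduct.mk i j).comp Monoid.Coprod.inr)

theorem AmalgamatedFreeProduct.iSup_range_of :
    ⨆ b, (AmalgamatedFreeProduct.of i j b).range = ⊤ := by
  rw [AmalgamatedFreeProduct.of, Factor.iSup_range_hom, ← Monoid.Coprod.range_eq]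
  exact MonoidHom.range_eq_top.2 (mk_surjective i j)

/-- The map from the amalgamated free product to the pushout. -/
def AmalgamatedFreeProduct.toPushout :
    AmalgamatedFreeProduct A B F i j →* Monoid.PushoutI (Factor.homTo i j) :=
  QuotientGroup.lift _ (Monoid.Coprod.lift (Monoid.PushoutI.of (φ := Factor.homTo i j) true)
    (Monoid.PushoutI.of (φ := Factor.homTo i j) false)) <| by
    refine fun x hx => MonoidHom.mem_ker.1 (Subgroup.normalClosure_le_normal ?_ hx)
    rintro _ ⟨k, rfl⟩
    have h1 := Monoid.PushoutI.of_apply_eq_base (Factor.homTo i j) true k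
    have h2 := Monoid.PushoutI.of_apply_eq_base (Factor.homTo i j) false k
    simp only [SetLike.mem_coe, MonoidHom.mem_ker, map_mul, map_inv]
    rw [mul_inv_eq_one]
    exact ((Monoid.Coprod.lift_apply_inl _ _ _).trans h1).trans
      ((Monoid.Coprod.lift_apply_inr _ _ _).trans h2).symm

theorem isAmalgam_amalgamatedFreeProduct (hi : Function.Injective i) (hj : Function.Injective j) :
    IsAmalgam (fun b => (Factor.homTo i j b).range) (AmalgamatedFreeProduct.of i j) := by
  refine IsAmalgam.of_pushout ?_ ?_ (AmalgamatedFreeProduct.toPushout i j) ?_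
  · rintro (_ | _)
    exacts [hj, hi]
  · have := AmalgamatedFreeProduct.mk_inl_eq_mk_inr i j
    rintro (_ | _) (_ | _) k
    exacts [rfl, (this k).symm, this k, rfl]
  · rintro (_ | _) g
    · exact Monoid.Coprod.lift_apply_inr (Monoid.PushoutI.of (φ := Factor.homTo i j) true)
        (Monoid.PushoutI.of (φ := Factor.homTo i j) false) g
    · exact Monoid.Coprod.lift_apply_inl (Monoid.PushoutI.of (φ := Factor.homTo i j) true)
        (Monoid.PushoutI.of (φ := Factor.homTo i j) false) g

end Factors

/-- A coarse equivalence of word metrics is a quasi-isometry. -/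
theorem IsCoarseEquivalence.exists_isQuasiIsometry {X Y : Type*} {dX : X → X → ℕ} {dY : Y → Y → ℕ}
    {f : X → Y} (h : IsCoarseEquivalence dX dY f) :
    ∃ K C : ℝ, 0 < K ∧ 0 ≤ C ∧
      IsQuasiIsometry K C (fun a b => (dX a b : ℝ)) (fun a b => (dY a b : ℝ)) f := by
  obtain ⟨K, hK, hK'⟩ := h
  have hpos : (0 : ℝ) < K + 1 := by positivity
  refine ⟨K + 1, K + 1, hpos, hpos.le, fun a b => ⟨?_, ?_⟩, fun y => ?_⟩
  · have h1 : (dX a b : ℝ) ≤ K * (dY (f a) (f b) + 1) := by exact_mod_cast (hK a b).2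
    have h2 : (0 : ℝ) ≤ dY (f a) (f b) := Nat.cast_nonneg _
    have h3 : (0 : ℝ) ≤ K := Nat.cast_nonneg _
    rw [one_div, inv_mul_eq_div, sub_le_iff_le_add, div_le_iff₀ hpos]
    nlinarith
  · have h1 : (dY (f a) (f b) : ℝ) ≤ K * (dX a b + 1) := by exact_mod_cast (hK a b).1
    have h2 : (0 : ℝ) ≤ dX a b := Nat.cast_nonneg _
    nlinarith
  · obtain ⟨x, hx⟩ := hK' y
    refine ⟨x, ?_⟩
    have : (dY (f x) y : ℝ) ≤ K := by exact_mod_cast hx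
    linarith

/-- **Theorem 2 (Amalgamation), first part.** Let `A` and `B` be finitely
generated groups and `F` a common finite proper subgroup (given by the
injections `i : F →* A` and `j : F →* B` with proper images).  Unless `F` is
of index 2 in both `A` and `B`, the free product `A * B` and the amalgamated
free product `A *_F B` are quasi-isometric. -/
theorem freeProduct_quasiIsometric_amalgamatedProduct
    (A B F : Type) [Group A] [Group B] [Group F] [Group.FG A] [Group.FG B] [Finite F]
    (i : F →* A) (j : F →* B) (hi : Function.Injective i) (hj : Function.Injective j)
    (hiProper : i.range ≠ ⊤) (hjProper : j.range ≠ ⊤)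
    (hIndex : ¬ (i.range.index = 2 ∧ j.range.index = 2)) :
    QuasiIsometricGroups (Monoid.Coprod A B) (AmalgamatedFreeProduct A B F i j) := by
  have hfg : ∀ b, ∃ S : Finset (Factor A B b), Subgroup.closure (S : Set (Factor A B b)) = ⊤ := by
    rintro (_ | _)
    exacts [(Group.FG.out : (⊤ : Subgroup B).FG), (Group.FG.out : (⊤ : Subgroup A).FG)]
  choose S hS using hfg
  have hfin : ∀ {Q : Type} [Group Q] (e : ∀ b, Factor A B b →* Q),
      ∃ T : Finset Q, (T : Set Q) = ⋃ b, e b '' S b := fun e =>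
    ⟨(Set.finite_iUnion fun b => (S b).finite_toSet.image (e b)).toFinset, by simp⟩
  obtain ⟨T, hT⟩ := hfin (Factor.hom (Monoid.Coprod.inl : A →* Monoid.Coprod A B) Monoid.Coprod.inr)
  obtain ⟨T', hT'⟩ := hfin (AmalgamatedFreeProduct.of i j)
  have hc := closure_iUnion_image_eq_top hS
    (e := Factor.hom (Monoid.Coprod.inl : A →* Monoid.Coprod A B) Monoid.Coprod.inr)
    (by rw [Factor.iSup_range_hom, Monoid.Coprod.range_inl_sup_range_inr])
  have hc' := closure_iUnion_image_eq_top hS (AmalgamatedFreeProduct.iSup_range_of i j)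
  have : ∀ b, Finite (Factor.homTo i j b).range := fun b =>
    Finite.of_surjective _ (Factor.homTo i j b).rangeRestrict_surjective
  have hproper : ∀ b, (Factor.homTo i j b).range ≠ ⊤ := by
    rintro (_ | _)
    exacts [hjProper, hiProper]
  obtain ⟨b, hb⟩ : ∃ b, (Factor.homTo i j b).range.index ≠ 2 := by
    by_contra! h
    exact hIndex ⟨h true, h false⟩
  obtain ⟨f, hf⟩ := isAmalgam_coprod.exists_isCoarseEquivalence
    (isAmalgam_amalgamatedFreeProduct i j hi hj) (isFactorLength_wordDist hS hc)
    (isFactorLength_wordDist hS hc') (fun b => isLength_wordDist (hS b)) hproper hb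
  simp only [← wordDist_eq, ← hT, ← hT'] at hf
  obtain ⟨K, C, hK, hC, hf⟩ := hf.exists_isQuasiIsometry
  exact ⟨T, T', by rw [hT, hc], by rw [hT', hc'], K, C, f, hK, hC, hf⟩
end

section
/- Let A be a finitely generated group and let F be a finite proper subgroup of A equipped with two embeddings into A, defining the HNN extension A*_F. Then A*_F is quasi-isometric to the free product A*ℤ. -/
/-- The axioms of a pseudometric, for distance functions with natural number values. -/
structure IsPseudoDist {X : Type*} (δ : X → X → ℕ) : Prop where
  refl : ∀ x, δ x x = 0
  symm : ∀ x y, δ x y = δ y x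
  tri : ∀ x y z, δ x z ≤ δ x y + δ y z

theorem IsPseudoDist.comap {X Y : Type*} {δ : Y → Y → ℕ} (h : IsPseudoDist δ) (f : X → Y) :
    IsPseudoDist fun x y => δ (f x) (f y) :=
  ⟨fun _ => h.refl _, fun _ _ => h.symm _ _, fun _ _ _ => h.tri _ _ _⟩

section WordDist

variable {G : Type*} [Group G] {S : Set G}

theorem exists_list_prod_eq (hS : Subgroup.closure S = ⊤) (g : G) :
    ∃ l : List G, (∀ x ∈ l, x ∈ S ∨ x⁻¹ ∈ S) ∧ l.prod = g := by
  have h : g ∈ (Subgroup.closure S).toSubmonoid := by rw [hS]; trivial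
  rw [Subgroup.closure_toSubmonoid] at h
  simpa using Submonoid.exists_list_of_mem_closure h

theorem wordDist_spec (hS : Subgroup.closure S = ⊤) (g h : G) :
    ∃ l : List G, l.length = wordDist S g h ∧ (∀ x ∈ l, x ∈ S ∨ x⁻¹ ∈ S) ∧
      l.prod = g⁻¹ * h := by
  obtain ⟨l, hl, hp⟩ := exists_list_prod_eq hS (g⁻¹ * h)
  exact Nat.sInf_mem (s := {n | ∃ l : List G, l.length = n ∧
    (∀ x ∈ l, x ∈ S ∨ x⁻¹ ∈ S) ∧ l.prod = g⁻¹ * h}) ⟨l.length, l, rfl, hl, hp⟩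

theorem wordDist_le_length {g h : G} {l : List G} (hl : ∀ x ∈ l, x ∈ S ∨ x⁻¹ ∈ S)
    (hp : l.prod = g⁻¹ * h) : wordDist S g h ≤ l.length :=
  Nat.sInf_le ⟨l, rfl, hl, hp⟩

theorem wordDist_mul_left (g x y : G) : wordDist S (g * x) (g * y) = wordDist S x y := by
  simp [wordDist, mul_assoc]

theorem wordDist_symm_le (hS : Subgroup.closure S = ⊤) (g h : G) :
    wordDist S h g ≤ wordDist S g h := by
  obtain ⟨l, hl, hm, hp⟩ := wordDist_spec hS g h
  rw [← hl, ← List.length_reverse, ← List.length_map (·⁻¹)]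
  refine wordDist_le_length (fun x hx => ?_) ?_
  · simp only [List.mem_map, List.mem_reverse] at hx
    obtain ⟨y, hy, rfl⟩ := hx
    simpa [or_comm] using hm y hy
  · rw [List.map_reverse, ← List.prod_inv_reverse, hp]
    simp

theorem isPseudoDist_wordDist (hS : Subgroup.closure S = ⊤) : IsPseudoDist (wordDist S) where
  refl x := by
    have := wordDist_le_length (S := S) (g := x) (h := x) (l := []) (by simp) (by simp)
    simpa using this
  symm x y := le_antisymm (wordDist_symm_le hS y x) (wordDist_symm_le hS x y)
  tri x y z := by
    obtain ⟨l, hl, hm, hp⟩ := wordDist_spec hS x y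
    obtain ⟨l', hl', hm', hp'⟩ := wordDist_spec hS y z
    rw [← hl, ← hl', ← List.length_append]
    refine wordDist_le_length (fun a ha => ?_) ?_
    · rcases List.mem_append.1 ha with h | h
      exacts [hm a h, hm' a h]
    · simp [hp, hp', mul_assoc]

/-- A pseudometric in which right multiplication by each generator moves points by at most `N`
is bounded by `N` times the word metric. -/
theorem IsPseudoDist.le_mul_wordDist (hS : Subgroup.closure S = ⊤) {δ : G → G → ℕ}
    (hδ : IsPseudoDist δ) {N : ℕ} (hN : ∀ s ∈ S, ∀ x, δ x (x * s) ≤ N) (x y : G) :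
    δ x y ≤ N * wordDist S x y := by
  obtain ⟨l, hl, hm, hp⟩ := wordDist_spec hS x y
  obtain rfl : y = x * l.prod := by simp [hp]
  rw [← hl]
  clear hl hp
  induction l generalizing x with
  | nil => simp [hδ.refl]
  | cons a l ih =>
    have h1 : δ x (x * a) ≤ N := by
      rcases hm a (by simp) with h | h
      · exact hN a h x
      · have := hN _ h (x * a)
        rw [hδ.symm]
        simpa using this
    have h2 := ih (x * a) fun b hb => hm b (by simp [hb])
    have h3 := hδ.tri x (x * a) (x * (a :: l).prod)
    simp only [List.prod_cons, List.length_cons, mul_add, ← mul_assoc, mul_one] at *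
    omega

end WordDist

/-- A map of groups which is coarsely compatible with left multiplications becomes Lipschitz for
the word metrics after conjugation with inversion. -/
theorem exists_wordDist_le {G H : Type*} [Group G] [Group H] {S : Finset G} {T : Finset H}
    (hS : Subgroup.closure (S : Set G) = ⊤) (hT : Subgroup.closure (T : Set H) = ⊤) {Ψ : G → H}
    (h : ∀ g, ∃ N, ∀ x, wordDist (T : Set H) (Ψ x)⁻¹ (Ψ (g * x))⁻¹ ≤ N) :
    ∃ N, ∀ x y, wordDist (T : Set H) (Ψ x⁻¹)⁻¹ (Ψ y⁻¹)⁻¹ ≤ N * wordDist (S : Set G) x y := by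
  choose N hN using h
  refine ⟨S.sup fun s => N s⁻¹, fun x y => ?_⟩
  refine ((isPseudoDist_wordDist hT).comap fun x => (Ψ x⁻¹)⁻¹).le_mul_wordDist hS ?_ x y
  intro s hs x
  have := hN s⁻¹ x⁻¹
  rw [← mul_inv_rev] at this
  exact this.trans (Finset.le_sup (f := fun s => N s⁻¹) hs)

/-- A bijection of finitely generated groups which is coarsely compatible with the left
multiplications, in both directions, gives a quasi-isometry. -/
theorem quasiIsometricGroups_of_equiv {G H : Type*} [Group G] [Group H] {S : Finset G}
    {T : Finset H} (hS : Subgroup.closure (S : Set G) = ⊤)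
    (hT : Subgroup.closure (T : Set H) = ⊤) (Ψ : G ≃ H)
    (h₁ : ∀ g, ∃ N, ∀ x, wordDist (T : Set H) (Ψ x)⁻¹ (Ψ (g * x))⁻¹ ≤ N)
    (h₂ : ∀ h, ∃ N, ∀ y, wordDist (S : Set G) (Ψ.symm y)⁻¹ (Ψ.symm (h * y))⁻¹ ≤ N) :
    QuasiIsometricGroups G H := by
  obtain ⟨N, hN⟩ := exists_wordDist_le hS hT h₁
  obtain ⟨M, hM⟩ := exists_wordDist_le hT hS h₂
  have hpos : (0 : ℝ) < N + M + 1 := by positivity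
  refine ⟨S, T, hS, hT, N + M + 1, 0, fun x => (Ψ x⁻¹)⁻¹, hpos, le_rfl, fun a b => ⟨?_, ?_⟩,
    fun y => ⟨(Ψ.symm y⁻¹)⁻¹, ?_⟩⟩
  · have h := hM (Ψ a⁻¹)⁻¹ (Ψ b⁻¹)⁻¹
    simp only [inv_inv, Equiv.symm_apply_apply] at h
    have h' : (wordDist (S : Set G) a b : ℝ) ≤
        M * wordDist (T : Set H) (Ψ a⁻¹)⁻¹ (Ψ b⁻¹)⁻¹ := by exact_mod_cast h
    rw [sub_zero, one_div, inv_mul_le_iff₀ hpos]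
    refine h'.trans ?_
    gcongr
    have : (0 : ℝ) ≤ N := by positivity
    linarith
  · have h' : (wordDist (T : Set H) (Ψ a⁻¹)⁻¹ (Ψ b⁻¹)⁻¹ : ℝ) ≤
        N * wordDist (S : Set G) a b := by exact_mod_cast hN a b
    rw [add_zero]
    refine h'.trans ?_
    gcongr
    have : (0 : ℝ) ≤ M := by positivity
    linarith
  · simp [(isPseudoDist_wordDist hT).refl]


/-- Points of a rooted tree of copies of `A` (two such trees, indexed by `ℤˣ`): the copies are
indexed by lists, and the copy with index `c :: L` is a child of the one with index `L`. A child
`some c` is attached at the position `pos c` of its parent, a child `none` at the position `1`;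
see `TreeControlled`. -/
abbrev TreePoint (A C : Type*) := A × ℤˣ × List (Option C)

/-- Points which are adjacent in the tree of copies of `A` are uniformly `δ`-close. -/
structure TreeControlled {A C : Type*} [Group A] (pos : C → A)
    (δ : TreePoint A C → TreePoint A C → ℕ) : Prop where
  mul_left : ∀ b, ∃ N, ∀ a σ L, δ (a, σ, L) (b * a, σ, L) ≤ N
  none_child : ∃ N, ∀ σ L, δ (1, σ, L) (1, σ, none :: L) ≤ N
  some_child : ∃ N, ∀ c σ L, δ (pos c, σ, L) (1, σ, some c :: L) ≤ N

theorem TreeControlled.mul_left_finite {A C : Type*} [Group A] {pos : C → A}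
    {δ : TreePoint A C → TreePoint A C → ℕ} (h : TreeControlled pos δ) {T : Set A}
    (hT : T.Finite) : ∃ N, ∀ b ∈ T, ∀ a σ L, δ (a, σ, L) (b * a, σ, L) ≤ N := by
  choose f hf using h.mul_left
  refine ⟨hT.toFinset.sup f, fun b hb a σ L => (hf b a σ L).trans (Finset.le_sup ?_)⟩
  simpa using hb

/-- Two ways of distributing the elements of `E` among the elements of `C`: for `q false`, every
element of `C` has a share; for `q true`, every element but `reserve` has. -/
structure SlotSystem (C E : Type*) where
  reserve : C
  q : Bool → E → C
  fib : Bool → C → List E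
  mem_fib : ∀ {b c e}, e ∈ fib b c ↔ q b e = c
  nodup : ∀ b c, (fib b c).Nodup
  ne_nil : ∀ {b c}, (b = true → c ≠ reserve) → fib b c ≠ []
  q_true_ne : ∀ e, q true e ≠ reserve

namespace SlotSystem

open Classical in
/-- Slots from finite fibres. -/
noncomputable def ofFinite {C E : Type*} (r : C) (q : Bool → E → C)
    (hfin : ∀ b c, {e | q b e = c}.Finite)
    (hsurj : ∀ b c, (b = true → c ≠ r) → ∃ e, q b e = c)
    (hr : ∀ e, q true e ≠ r) : SlotSystem C E where
  reserve := r
  q := q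
  fib b c := (hfin b c).toFinset.toList
  mem_fib := by simp
  nodup b c := Finset.nodup_toList _
  ne_nil {b c} h := by
    obtain ⟨e, he⟩ := hsurj b c h
    exact List.ne_nil_of_mem (a := e) (by simpa using he)
  q_true_ne := hr

variable {C E : Type*} (s : SlotSystem C E)

/-- Attach to `P` the children listed in the first argument; the first of these is the address
of the current copy, the others are addresses still to be used. -/
def assign (P : List (Option E)) : List E → List (Option E) × List (List (Option E))
  | [] => (P, [])
  | e :: l => (some e :: P, l.map fun x => some x :: P)

open Classical in
/-- The new address of a copy, together with the list of addresses to be filled by the children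
`reserve` of this copy and of its iterated `none` descendants. -/
noncomputable def encode : List (Option C) → List (Option E) × List (List (Option E))
  | [] => ([], [])
  | none :: L => (none :: (encode L).1, (encode L).2.tail)
  | some c :: L =>
    match (encode L).2 with
    | [] => assign (encode L).1 (s.fib false c)
    | y :: _ => if c = s.reserve then (y, []) else assign (encode L).1 (s.fib true c)

open Classical in
/-- The inverse of `encode`; the second component is the number of descendants `reserve` placed
elsewhere. -/
noncomputable def decode : List (Option E) → List (Option C) × ℕ
  | [] => ([], 0)
  | none :: P => (none :: (decode P).1, (decode P).2 - 1)
  | some e :: P =>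
    let b := decide ((decode P).2 ≠ 0)
    match (s.fib b (s.q b e)).idxOf e with
    | 0 => (some (s.q b e) :: (decode P).1, (s.fib b (s.q b e)).length - 1)
    | i + 1 => (some s.reserve :: (List.replicate i none ++ some (s.q b e) :: (decode P).1), 0)

theorem decode_some_head {b : Bool} {c : C} {e : E} {l : List E} {P : List (Option E)}
    (hb : b = decide ((s.decode P).2 ≠ 0)) (h : s.fib b c = e :: l) :
    s.decode (some e :: P) = (some c :: (s.decode P).1, l.length) := by
  have hq : s.q b e = c := s.mem_fib.1 (by simp [h])
  subst hb
  simp only [decode, hq, h, List.idxOf_cons_self]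
  simp

open Classical in
theorem decode_some_tail {b : Bool} {c : C} {e : E} {l : List E} {P : List (Option E)} {i : ℕ}
    (hi : i < l.length) (hb : b = decide ((s.decode P).2 ≠ 0)) (h : s.fib b c = e :: l) :
    s.decode (some l[i] :: P) =
      (some s.reserve :: (List.replicate i none ++ some c :: (s.decode P).1), 0) := by
  have hq : s.q b l[i] = c := s.mem_fib.1 (by simp [h])
  have hidx : (s.fib b c).idxOf l[i] = i + 1 := by
    have hlt : i + 1 < (s.fib b c).length := by simp [h, hi]
    have := (s.nodup b c).idxOf_getElem (i + 1) hlt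
    simpa [h] using this
  subst hb
  simp only [decode, hq, hidx]

/-- What remains to be checked when the copy `some c :: L` is given the children in `l`. -/
theorem decode_assign {b : Bool} {c : C} {P : List (Option E)}
    (hb : b = decide ((s.decode P).2 ≠ 0)) (hc : s.fib b c ≠ []) :
    s.decode (assign P (s.fib b c)).1 =
        (some c :: (s.decode P).1, (assign P (s.fib b c)).2.length) ∧
      ∀ i (hi : i < (assign P (s.fib b c)).2.length), s.decode (assign P (s.fib b c)).2[i] =
        (some s.reserve :: (List.replicate i none ++ some c :: (s.decode P).1), 0) := by
  obtain ⟨e, l, h⟩ := List.exists_cons_of_ne_nil hc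
  simp only [h, assign]
  refine ⟨by simpa using s.decode_some_head hb h, fun i hi => ?_⟩
  simp only [List.length_map] at hi
  simpa using s.decode_some_tail hi hb h

theorem decode_encode_aux (L : List (Option C)) :
    s.decode (s.encode L).1 = (L, (s.encode L).2.length) ∧
      ∀ i (hi : i < (s.encode L).2.length), s.decode (s.encode L).2[i] =
        (some s.reserve :: (List.replicate i none ++ L), 0) := by
  induction L with
  | nil => simp [encode, decode]
  | cons o L ih =>
    obtain ⟨ih₁, ih₂⟩ := ih
    cases o with
    | none =>
      refine ⟨by simp [encode, decode, ih₁], fun i hi => ?_⟩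
      simp only [encode, List.length_tail] at hi
      have := ih₂ (i + 1) (by omega)
      simp only [encode, List.getElem_tail, this]
      simp [List.replicate_succ']
    | some c =>
      rcases hQ : (s.encode L).2 with _ | ⟨y, Q⟩
      · have h := s.decode_assign (b := false) (c := c) (P := (s.encode L).1)
          (by simp [ih₁, hQ]) (s.ne_nil (by simp))
        rw [ih₁] at h
        simpa only [encode, hQ] using h
      · by_cases hc : c = s.reserve
        · have := ih₂ 0 (by simp [hQ])
          simp only [hQ, List.getElem_cons_zero] at this
          simp [encode, hQ, hc, this]
        · have h := s.decode_assign (b := true) (c := c) (P := (s.encode L).1)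
            (by simp [ih₁, hQ]) (s.ne_nil (by simpa using hc))
          rw [ih₁] at h
          simpa only [encode, hQ, if_neg hc] using h

theorem decode_encode (L : List (Option C)) : (s.decode (s.encode L).1).1 = L := by
  rw [(s.decode_encode_aux L).1]

theorem encode_replicate_append (i : ℕ) (L : List (Option C)) :
    (s.encode (List.replicate i none ++ L)).2 = (s.encode L).2.drop i := by
  induction i with
  | zero => simp
  | succ i ih => simp [List.replicate_succ, encode, ih]

theorem encode_decode_aux (P : List (Option E)) :
    (s.encode (s.decode P).1).1 = P ∧ (s.encode (s.decode P).1).2.length = (s.decode P).2 := by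
  induction P with
  | nil => simp [encode, decode]
  | cons o P ih =>
    obtain ⟨ih₁, ih₂⟩ := ih
    cases o with
    | none => simp [encode, decode, ih₁, ih₂]
    | some e =>
      obtain ⟨b, hb⟩ : ∃ b, b = decide ((s.decode P).2 ≠ 0) := ⟨_, rfl⟩
      obtain ⟨c, hc⟩ : ∃ c, s.q b e = c := ⟨_, rfl⟩
      have henc : s.encode (some c :: (s.decode P).1) = assign P (s.fib b c) := by
        rcases hQ : (s.encode (s.decode P).1).2 with _ | ⟨y, Q⟩
        · have : b = false := by simp [hb, ← ih₂, hQ]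
          simp [encode, hQ, ih₁, this]
        · have : b = true := by simp [hb, ← ih₂, hQ]
          subst this
          have : c ≠ s.reserve := hc ▸ s.q_true_ne e
          simp [encode, hQ, ih₁, this]
      have hmem : e ∈ s.fib b c := s.mem_fib.2 hc
      rcases hf : s.fib b c with _ | ⟨e', l⟩
      · simp [hf] at hmem
      rw [hf] at henc
      rcases eq_or_ne e e' with rfl | hne
      · simp [s.decode_some_head hb hf, henc, assign]
      · have hl : e ∈ l := by simpa [hf, hne] using hmem
        obtain ⟨i, hi, rfl⟩ := List.getElem_of_mem hl
        have hQ : (s.encode (List.replicate i none ++ some c :: (s.decode P).1)).2 =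
            (some l[i] :: P) :: (l.drop (i + 1)).map fun x => some x :: P := by
          rw [encode_replicate_append, henc, assign, ← List.map_drop, List.drop_eq_getElem_cons hi,
            List.map_cons]
        rw [s.decode_some_tail hi hb hf]
        simp only [encode, hQ]
        simp

theorem encode_decode (P : List (Option E)) : (s.encode (s.decode P).1).1 = P :=
  (s.encode_decode_aux P).1

/-- The two trees have the same copies of `A`. -/
noncomputable def treeEquiv (A : Type*) : TreePoint A C ≃ TreePoint A E where
  toFun x := (x.1, x.2.1, (s.encode x.2.2).1)
  invFun y := (y.1, y.2.1, (s.decode y.2.2).1)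
  left_inv x := by simp [decode_encode]
  right_inv y := by simp [encode_decode]

end SlotSystem

namespace SlotSystem

variable {A C E : Type*} [Group A] {s : SlotSystem C E} {pos : C → A} {pos' : E → A} {T : Set A}

theorem exists_slot_bound {δ : TreePoint A E → TreePoint A E → ℕ} (hδ : IsPseudoDist δ)
    (h : TreeControlled pos' δ) (hT : T.Finite)
    (hs : ∀ b e, pos' e * (pos (s.q b e))⁻¹ ∈ T) :
    ∃ N, ∀ b e σ P, δ (pos (s.q b e), σ, P) (1, σ, some e :: P) ≤ N := by
  obtain ⟨N₁, h₁⟩ := h.mul_left_finite hT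
  obtain ⟨N₂, h₂⟩ := h.some_child
  refine ⟨N₁ + N₂, fun b e σ P => ?_⟩
  have h3 := h₁ _ (hs b e) (pos (s.q b e)) σ P
  rw [inv_mul_cancel_right] at h3
  have h4 := h₂ e σ P
  have h5 := hδ.tri (pos (s.q b e), σ, P) (pos' e, σ, P) (1, σ, some e :: P)
  omega

theorem exists_pending_bound {δ : TreePoint A E → TreePoint A E → ℕ} (hδ : IsPseudoDist δ)
    (h : TreeControlled pos' δ) (hT : T.Finite)
    (hs : ∀ b e, pos' e * (pos (s.q b e))⁻¹ ∈ T) {M : ℕ} (hM : ∀ b c, (s.fib b c).length ≤ M) :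
    ∃ N, ∀ σ L, ∀ y ∈ (s.encode L).2, δ (1, σ, (s.encode L).1) (1, σ, y) ≤ N := by
  obtain ⟨N₁, h₁⟩ := h.none_child
  obtain ⟨N₂, h₂⟩ := exists_slot_bound hδ h hT hs
  have key : ∀ σ L, (s.encode L).2.length ≤ M ∧ ∀ y ∈ (s.encode L).2,
      δ (1, σ, (s.encode L).1) (1, σ, y) + N₁ * (s.encode L).2.length ≤ N₁ * M + 2 * N₂ := by
    intro σ L
    have assign_bound : ∀ b c P, (s.fib b c) ≠ [] → (assign P (s.fib b c)).2.length ≤ M ∧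
        ∀ y ∈ (assign P (s.fib b c)).2, δ (1, σ, (assign P (s.fib b c)).1) (1, σ, y) +
          N₁ * (assign P (s.fib b c)).2.length ≤ N₁ * M + 2 * N₂ := by
      intro b c P hne
      obtain ⟨e, l, hl⟩ := List.exists_cons_of_ne_nil hne
      have hlen : l.length ≤ M := by
        have := hM b c
        simp only [hl, List.length_cons] at this
        omega
      rw [hl]
      simp only [assign, List.length_map, List.mem_map, forall_exists_index, and_imp,
        forall_apply_eq_imp_iff₂]
      refine ⟨hlen, fun x hx => ?_⟩
      have he : s.q b e = c := s.mem_fib.1 (by simp [hl])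
      have hx' : s.q b x = c := s.mem_fib.1 (by simp [hl, hx])
      have h3 := h₂ b e σ P
      have h4 := h₂ b x σ P
      rw [he, hδ.symm] at h3
      rw [hx'] at h4
      have h5 := hδ.tri (1, σ, some e :: P) (pos c, σ, P) (1, σ, some x :: P)
      have h6 := Nat.mul_le_mul_left N₁ hlen
      omega
    induction L with
    | nil => simp [encode]
    | cons o L ih =>
      obtain ⟨ih₁, ih₂⟩ := ih
      cases o with
      | none =>
        simp only [encode]
        rcases hQ : (s.encode L).2 with _ | ⟨z, Q⟩
        · simp
        · rw [hQ] at ih₁ ih₂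
          simp only [List.tail_cons]
          simp only [List.length_cons] at ih₁ ih₂
          refine ⟨by omega, fun y hy => ?_⟩
          have h3 := ih₂ y (List.mem_cons_of_mem _ hy)
          have h4 := h₁ σ (s.encode L).1
          rw [hδ.symm] at h4
          have h5 := hδ.tri (1, σ, none :: (s.encode L).1) (1, σ, (s.encode L).1) (1, σ, y)
          rw [mul_add] at h3
          omega
      | some c =>
        rcases hQ : (s.encode L).2 with _ | ⟨z, Q⟩
        · simpa only [encode, hQ] using assign_bound false c _ (s.ne_nil (by simp))
        · by_cases hc : c = s.reserve
          · simp [encode, hQ, hc]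
          · simpa only [encode, hQ, if_neg hc] using assign_bound true c _ (s.ne_nil (by simpa))
  refine ⟨N₁ * M + 2 * N₂, fun σ L y hy => ?_⟩
  have := (key σ L).2 y hy
  omega

theorem treeControlled_treeEquiv {δ : TreePoint A E → TreePoint A E → ℕ} (hδ : IsPseudoDist δ)
    (h : TreeControlled pos' δ) (hT : T.Finite)
    (hs : ∀ b e, pos' e * (pos (s.q b e))⁻¹ ∈ T) {M : ℕ} (hM : ∀ b c, (s.fib b c).length ≤ M) :
    TreeControlled pos fun x y => δ (s.treeEquiv A x) (s.treeEquiv A y) where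
  mul_left b := (h.mul_left b).imp fun N hN a σ L => hN a σ _
  none_child := h.none_child.imp fun N hN σ L => hN σ _
  some_child := by
    obtain ⟨N₁, h₁⟩ := exists_slot_bound hδ h hT hs
    obtain ⟨N₂, h₂⟩ := exists_pending_bound hδ h hT hs hM
    obtain ⟨N₃, h₃⟩ := h.mul_left (pos s.reserve)⁻¹
    have assign_bound : ∀ b c σ P, (s.fib b c) ≠ [] →
        δ (pos c, σ, P) (1, σ, (assign P (s.fib b c)).1) ≤ N₁ := by
      intro b c σ P hne
      obtain ⟨e, l, hl⟩ := List.exists_cons_of_ne_nil hne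
      have he : s.q b e = c := s.mem_fib.1 (by simp [hl])
      have := h₁ b e σ P
      rw [he] at this
      simpa [hl, assign] using this
    refine ⟨N₁ + N₂ + N₃, fun c σ L => ?_⟩
    change δ (pos c, σ, (s.encode L).1) (1, σ, (s.encode (some c :: L)).1) ≤ _
    rcases hQ : (s.encode L).2 with _ | ⟨z, Q⟩
    · have := assign_bound false c σ (s.encode L).1 (s.ne_nil (by simp))
      simp only [encode, hQ]
      omega
    · by_cases hc : c = s.reserve
      · have h4 := h₂ σ L z (by simp [hQ])
        have h5 := h₃ (pos c) σ (s.encode L).1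
        have h6 := hδ.tri (pos c, σ, (s.encode L).1) (1, σ, (s.encode L).1) (1, σ, z)
        rw [← hc, inv_mul_cancel] at h5
        simp only [encode, hQ, if_pos hc]
        omega
      · have := assign_bound true c σ (s.encode L).1 (s.ne_nil (by simpa))
        simp only [encode, hQ, if_neg hc]
        omega

theorem treeControlled_treeEquiv_symm {δ : TreePoint A C → TreePoint A C → ℕ}
    (hδ : IsPseudoDist δ) (h : TreeControlled pos δ) (hT : T.Finite)
    (hs : ∀ b e, pos' e * (pos (s.q b e))⁻¹ ∈ T) {M : ℕ} (hM : ∀ b c, (s.fib b c).length ≤ M) :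
    TreeControlled pos' fun x y => δ ((s.treeEquiv A).symm x) ((s.treeEquiv A).symm y) where
  mul_left b := (h.mul_left b).imp fun N hN a σ L => hN a σ _
  none_child := h.none_child.imp fun N hN σ L => hN σ _
  some_child := by
    obtain ⟨N₁, h₁⟩ := h.mul_left_finite hT
    obtain ⟨N₂, h₂⟩ := h.some_child
    obtain ⟨N₃, h₃⟩ := h.none_child
    obtain ⟨N₄, h₄⟩ := h.mul_left (pos s.reserve)
    have hrep : ∀ i σ L, δ (1, σ, L) (1, σ, List.replicate i none ++ L) ≤ i * N₃ := by
      intro i σ L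
      induction i with
      | zero => simp [hδ.refl]
      | succ i ih =>
        have h5 := h₃ σ (List.replicate i none ++ L)
        have h6 := hδ.tri (1, σ, L) (1, σ, List.replicate i none ++ L)
          (1, σ, none :: (List.replicate i none ++ L))
        rw [add_mul, List.replicate_succ, List.cons_append]
        omega
    refine ⟨N₁ + N₂ + M * N₃ + N₄ + N₂, fun e σ P => ?_⟩
    change δ (pos' e, σ, (s.decode P).1) (1, σ, (s.decode (some e :: P)).1) ≤ _
    obtain ⟨b, hb⟩ : ∃ b, b = decide ((s.decode P).2 ≠ 0) := ⟨_, rfl⟩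
    obtain ⟨c, hc⟩ : ∃ c, s.q b e = c := ⟨_, rfl⟩
    set L := (s.decode P).1
    have h5 : δ (pos' e, σ, L) (pos c, σ, L) ≤ N₁ := by
      have := h₁ _ (hs b e) (pos (s.q b e)) σ L
      rwa [inv_mul_cancel_right, hδ.symm, hc] at this
    have h6 := h₂ c σ L
    have h7 := hδ.tri (pos' e, σ, L) (pos c, σ, L) (1, σ, some c :: L)
    have hmem : e ∈ s.fib b c := s.mem_fib.2 hc
    rcases hf : s.fib b c with _ | ⟨e', l⟩
    · simp [hf] at hmem
    rcases eq_or_ne e e' with rfl | hne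
    · rw [s.decode_some_head hb hf]
      change δ _ (1, σ, some c :: L) ≤ _
      omega
    · have hl : e ∈ l := by simpa [hf, hne] using hmem
      obtain ⟨i, hi, rfl⟩ := List.getElem_of_mem hl
      rw [s.decode_some_tail hi hb hf]
      change δ _ (1, σ, some s.reserve :: (List.replicate i none ++ some c :: L)) ≤ _
      obtain ⟨L', hL'⟩ : ∃ L', L' = List.replicate i none ++ some c :: L := ⟨_, rfl⟩
      have hiM : i ≤ M := by
        have := hM b c
        simp only [hf, List.length_cons] at this
        omega
      have h8 := (hrep i σ (some c :: L)).trans (Nat.mul_le_mul_right N₃ hiM)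
      rw [← hL'] at h8 ⊢
      have h9 := h₄ 1 σ L'
      rw [mul_one] at h9
      have h10 := h₂ s.reserve σ L'
      have h11 := hδ.tri (pos' l[i], σ, L) (1, σ, some c :: L) (1, σ, L')
      have h12 := hδ.tri (pos' l[i], σ, L) (1, σ, L') (pos s.reserve, σ, L')
      have h13 := hδ.tri (pos' l[i], σ, L) (pos s.reserve, σ, L') (1, σ, some s.reserve :: L')
      omega

end SlotSystem

namespace HNNExtension

open NormalWord

variable {A : Type*} [Group A] {F K : Subgroup A} {φ : F ≃* K}

theorem exists_zpow_t_mul_of (v : ℤˣ) {a : A} (ha : a ∈ toSubgroup F K v) :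
    ∃ b ∈ toSubgroup F K (-v),
      (t ^ (v : ℤ) * of a : HNNExtension A F K φ) = of b * t ^ (v : ℤ) := by
  rcases Int.units_eq_one_or v with rfl | rfl
  · exact ⟨φ ⟨a, ha⟩, (φ ⟨a, ha⟩).2, by simpa using t_mul_of (φ := φ) ⟨a, ha⟩⟩
  · exact ⟨φ.symm ⟨a, ha⟩, (φ.symm ⟨a, ha⟩).2, by simpa using inv_t_mul_of (φ := φ) ⟨a, ha⟩⟩

/-- The nontrivial coset representatives, for both subgroups. -/
abbrev NontrivialRep (d : TransversalPair A F K) : Type _ :=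
  {c : ℤˣ × A // c.2 ∈ d.set c.1 ∧ c.2 ≠ 1}

variable {d : TransversalPair A F K}

/-- The exponent of the first letter of a word; it is `σ` for the empty word. -/
def firstSign (σ : ℤˣ) : List (Option (NontrivialRep d)) → ℤˣ
  | [] => σ
  | none :: L => firstSign σ L
  | some c :: _ => c.1.1

/-- The letters of the normal word described by a list: `none` repeats the previous exponent with
trivial coset representative, and the word ends with `t⁻¹` if `σ = -1`. -/
def letters (σ : ℤˣ) : List (Option (NontrivialRep d)) → List (ℤˣ × A)
  | [] => if σ = 1 then [] else [(-1, 1)]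
  | none :: L => (firstSign σ L, 1) :: letters σ L
  | some c :: L => c.1 :: letters σ L

theorem fst_eq_firstSign {σ : ℤˣ} {L : List (Option (NontrivialRep d))} {x : ℤˣ × A}
    (hx : x ∈ (letters σ L).head?) : x.1 = firstSign σ L := by
  rcases L with _ | ⟨_ | c, L⟩
  · rcases Int.units_eq_one_or σ with rfl | rfl
    · simp [letters] at hx
    · simp only [letters, firstSign] at hx ⊢
      simp at hx
      simp [← hx]
  · simp only [letters, List.head?_cons, Option.mem_some_iff] at hx
    simp [← hx, firstSign]
  · simp only [letters, List.head?_cons, Option.mem_some_iff] at hx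
    simp [← hx, firstSign]

theorem eq_nil_of_letters_eq_nil {σ : ℤˣ} {L : List (Option (NontrivialRep d))}
    (h : letters σ L = []) : L = [] ∧ σ = 1 := by
  rcases L with _ | ⟨_ | c, L⟩
  · simpa [letters] using h
  · simp [letters] at h
  · simp [letters] at h

theorem letters_injective {σ σ' : ℤˣ} {L L' : List (Option (NontrivialRep d))}
    (h : letters σ L = letters σ' L') : σ = σ' ∧ L = L' := by
  induction L generalizing L' with
  | nil =>
    rcases L' with _ | ⟨_ | c, L'⟩
    · rcases Int.units_eq_one_or σ with rfl | rfl <;>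
        rcases Int.units_eq_one_or σ' with rfl | rfl <;> simp_all [letters]
    · rcases Int.units_eq_one_or σ with rfl | rfl
      · simp [letters] at h
      · simp only [letters] at h
        simp only [show (-1 : ℤˣ) ≠ 1 by decide, if_false, List.cons.injEq, Prod.mk.injEq] at h
        obtain ⟨rfl, rfl⟩ := eq_nil_of_letters_eq_nil h.2.symm
        simp [firstSign] at h
    · rcases Int.units_eq_one_or σ with rfl | rfl
      · simp [letters] at h
      · simp only [letters] at h
        simp only [show (-1 : ℤˣ) ≠ 1 by decide, if_false, List.cons.injEq] at h
        exact absurd (by rw [← h.1]) c.2.2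
  | cons o L ih =>
    rcases o with _ | c
    · rcases L' with _ | ⟨_ | c', L'⟩
      · rcases Int.units_eq_one_or σ' with rfl | rfl
        · simp [letters] at h
        · simp only [letters] at h
          simp only [show (-1 : ℤˣ) ≠ 1 by decide, if_false, List.cons.injEq, Prod.mk.injEq] at h
          obtain ⟨rfl, rfl⟩ := eq_nil_of_letters_eq_nil h.2
          simp [firstSign] at h
      · simp only [letters, List.cons.injEq] at h
        obtain ⟨rfl, rfl⟩ := ih h.2
        exact ⟨rfl, rfl⟩
      · simp only [letters, List.cons.injEq] at h
        exact absurd (by rw [← h.1]) c'.2.2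
    · rcases L' with _ | ⟨_ | c', L'⟩
      · rcases Int.units_eq_one_or σ' with rfl | rfl
        · simp [letters] at h
        · simp only [letters] at h
          simp only [show (-1 : ℤˣ) ≠ 1 by decide, if_false, List.cons.injEq] at h
          exact absurd (by rw [h.1]) c.2.2
      · simp only [letters, List.cons.injEq] at h
        exact absurd (by rw [h.1]) c.2.2
      · simp only [letters, List.cons.injEq] at h
        obtain ⟨rfl, rfl⟩ := ih h.2
        exact ⟨rfl, by rw [Subtype.ext h.1]⟩

variable (hd : ∀ u, (1 : A) ∈ d.set u)

include hd in
theorem mem_set_of_mem_letters {σ : ℤˣ} {L : List (Option (NontrivialRep d))} {x : ℤˣ × A}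
    (hx : x ∈ letters σ L) : x.2 ∈ d.set x.1 := by
  induction L with
  | nil =>
    rcases Int.units_eq_one_or σ with rfl | rfl
    · simp [letters] at hx
    · simp only [letters, show (-1 : ℤˣ) ≠ 1 by decide, if_false, List.mem_singleton] at hx
      rw [hx]
      exact hd _
  | cons o L ih =>
    rcases o with _ | c
    · simp only [letters, List.mem_cons] at hx
      rcases hx with rfl | hx
      exacts [hd _, ih hx]
    · simp only [letters, List.mem_cons] at hx
      rcases hx with rfl | hx
      exacts [c.2.1, ih hx]

include hd in
theorem eq_one_of_mem_set_of_mem {u : ℤˣ} {a : A} (ha : a ∈ d.set u)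
    (ha' : a ∈ toSubgroup F K u) : a = 1 := by
  have h1 := (d.compl u).equiv_snd_eq_self_of_mem_of_one_mem (one_mem _) ha
  have h2 := (d.compl u).equiv_snd_eq_one_of_mem_of_one_mem (hd u) ha'
  simpa using congrArg Subtype.val (h1.symm.trans h2)

include hd in
theorem isChain_letters (σ : ℤˣ) (L : List (Option (NontrivialRep d))) :
    (letters σ L).IsChain fun a b => a.2 ∈ toSubgroup F K a.1 → a.1 = b.1 := by
  induction L with
  | nil => rcases Int.units_eq_one_or σ with rfl | rfl <;> simp [letters]
  | cons o L ih =>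
    rcases o with _ | c
    · exact List.isChain_cons.2 ⟨fun y hy _ => (fst_eq_firstSign hy).symm, ih⟩
    · exact List.isChain_cons.2
        ⟨fun y _ h => absurd (eq_one_of_mem_set_of_mem hd c.2.1 h) c.2.2, ih⟩

/-- The normal word of a tree point. -/
def toNormalWord (x : TreePoint A (NontrivialRep d)) : NormalWord d where
  head := x.1
  toList := letters x.2.1 x.2.2
  chain := isChain_letters hd _ _
  mem_set _ _ h := mem_set_of_mem_letters hd h

variable (φ) in
/-- The element of the HNN extension described by a tree point. -/
def eval (x : TreePoint A (NontrivialRep d)) : HNNExtension A F K φ :=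
  of x.1 * ((letters x.2.1 x.2.2).map fun y => t ^ (y.1 : ℤ) * of y.2).prod

include hd in
theorem eval_injective : Function.Injective (eval (d := d) φ) := by
  rintro ⟨a, σ, L⟩ ⟨a', σ', L'⟩ h
  have h' : toNormalWord hd (a, σ, L) = toNormalWord hd (a', σ', L') := prod_injective φ d h
  obtain ⟨rfl, rfl⟩ := letters_injective (congrArg (fun w => w.toList) h')
  obtain rfl : a = a' := congrArg (fun w => w.head) h'
  rfl

theorem eval_mul (b a : A) (σ : ℤˣ) (L : List (Option (NontrivialRep d))) :
    eval φ (b * a, σ, L) = of b * eval φ (a, σ, L) := by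
  simp [eval, mul_assoc]

theorem eval_none (σ : ℤˣ) (L : List (Option (NontrivialRep d))) :
    eval φ (1, σ, none :: L) = t ^ (firstSign σ L : ℤ) * eval φ (1, σ, L) := by
  simp [eval, letters]

theorem eval_some (c : NontrivialRep d) (σ : ℤˣ) (L : List (Option (NontrivialRep d))) :
    eval φ (1, σ, some c :: L) = t ^ (c.1.1 : ℤ) * eval φ (c.1.2, σ, L) := by
  simp [eval, letters, mul_assoc]

theorem eval_nil_neg (σ : ℤˣ) :
    eval φ (1, -σ, ([] : List (Option (NontrivialRep d)))) =
      t ^ ((-σ : ℤˣ) : ℤ) * eval φ (1, σ, ([] : List (Option (NontrivialRep d)))) := by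
  rcases Int.units_eq_one_or σ with rfl | rfl <;> simp [eval, letters]

theorem treeControlled_eval {δ : HNNExtension A F K φ → HNNExtension A F K φ → ℕ}
    (hδ : ∀ x y g, δ (x * g) (y * g) = δ x y) :
    TreeControlled (fun c : NontrivialRep d => c.1.2) fun x y => δ (eval φ x) (eval φ y) := by
  have h (g x) : δ x (g * x) = δ 1 g := by simpa using hδ 1 g x
  have ht (v : ℤˣ) (x) : δ x (t ^ (v : ℤ) * x) ≤ δ 1 t + δ 1 t⁻¹ := by
    rw [h]
    rcases Int.units_eq_one_or v with rfl | rfl <;> simp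
  refine ⟨fun b => ⟨δ 1 (of b), fun a σ L => ?_⟩, ⟨δ 1 t + δ 1 t⁻¹, fun σ L => ?_⟩,
    ⟨δ 1 t + δ 1 t⁻¹, fun c σ L => ?_⟩⟩
  · rw [eval_mul, h]
  · rw [eval_none]
    exact ht _ _
  · rw [eval_some]
    exact ht _ _

theorem exists_zpow_t_bound [Finite F] {δ : TreePoint A (NontrivialRep d) → TreePoint A
    (NontrivialRep d) → ℕ} (hδ : IsPseudoDist δ) (h : TreeControlled (fun c => c.1.2) δ) (v : ℤˣ) :
    ∃ N, ∀ x, ∃ x', eval φ x' = t ^ (v : ℤ) * eval φ x ∧ δ x x' ≤ N := by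
  have hfin (u : ℤˣ) : (toSubgroup F K u : Set A).Finite := by
    rcases Int.units_eq_one_or u with rfl | rfl
    · exact Set.toFinite (F : Set A)
    · have : Finite K := .of_equiv F φ.toEquiv
      exact Set.toFinite (K : Set A)
  obtain ⟨N₁, h₁⟩ := h.mul_left_finite (hfin v)
  obtain ⟨N₁', h₁'⟩ := h.mul_left_finite (hfin (-v))
  obtain ⟨N₂, h₂⟩ := h.none_child
  obtain ⟨N₃, h₃⟩ := h.some_child
  have core : ∃ N, ∀ a ∈ d.set v, ∀ σ L, ∃ x',
      eval φ (1 * x'.1, x'.2) = t ^ (v : ℤ) * eval φ (a, σ, L) ∧ δ (a, σ, L) x' ≤ N := by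
    refine ⟨N₂ + N₃ + δ (1, v, []) (1, -v, []) + δ (1, -v, []) (1, v, []),
      fun a ha σ L => ?_⟩
    simp only [one_mul]
    rcases eq_or_ne a 1 with rfl | hne
    · rcases eq_or_ne v (firstSign σ L) with rfl | hv
      · refine ⟨(1, σ, none :: L), eval_none σ L, ?_⟩
        have := h₂ σ L
        omega
      · have hv' : firstSign σ L = -v := by
          rcases Int.units_eq_one_or v with rfl | rfl <;>
            rcases Int.units_eq_one_or (firstSign σ L) with h | h <;> simp_all
        rcases L with _ | ⟨_ | c, L⟩
        · obtain rfl : σ = -v := hv'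
          refine ⟨(1, v, []), by simpa using eval_nil_neg (φ := φ) (d := d) (-v), ?_⟩
          omega
        · refine ⟨(1, σ, L), ?_, ?_⟩
          · rw [eval_none, show firstSign σ L = -v from hv']
            simp [← mul_assoc]
          · have := h₂ σ L
            rw [hδ.symm]
            omega
        · refine ⟨(c.1.2, σ, L), ?_, ?_⟩
          · rw [eval_some, show c.1.1 = -v from hv']
            simp [← mul_assoc]
          · have := h₃ c σ L
            rw [hδ.symm]
            omega
    · refine ⟨(1, σ, some ⟨(v, a), ha, hne⟩ :: L), eval_some _ σ L, ?_⟩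
      exact (h₃ ⟨(v, a), ha, hne⟩ σ L).trans (by omega)
  obtain ⟨N₄, h₄⟩ := core
  refine ⟨N₁ + N₄ + N₁', fun ⟨a, σ, L⟩ => ?_⟩
  obtain ⟨⟨s, r⟩, rfl⟩ : ∃ p : toSubgroup F K v × d.set v, a = p.1 * p.2 :=
    ⟨(d.compl v).equiv a, ((d.compl v).equiv_fst_mul_equiv_snd a).symm⟩
  obtain ⟨⟨a', σ', L'⟩, hx', hδ'⟩ := h₄ r r.2 σ L
  obtain ⟨b, hb, hb'⟩ := exists_zpow_t_mul_of (φ := φ) v s.2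
  refine ⟨(b * a', σ', L'), ?_, ?_⟩
  · rw [one_mul] at hx'
    rw [eval_mul, eval_mul, hx', ← mul_assoc, ← mul_assoc, ← hb']
  · have h5 := h₁ s s.2 r σ L
    rw [hδ.symm] at h5
    have h6 := h₁' b hb a' σ' L'
    have h7 := hδ.tri (s * r, σ, L) (r, σ, L) (a', σ', L')
    have h8 := hδ.tri (s * r, σ, L) (a', σ', L') (b * a', σ', L')
    exact h8.trans (by omega)

theorem exists_mul_bound [Finite F] {δ : TreePoint A (NontrivialRep d) → TreePoint A
    (NontrivialRep d) → ℕ} (hδ : IsPseudoDist δ) (h : TreeControlled (fun c => c.1.2) δ)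
    (g : HNNExtension A F K φ) :
    ∃ N, ∀ x, ∃ x', eval φ x' = g * eval φ x ∧ δ x x' ≤ N := by
  let P (g : HNNExtension A F K φ) : Prop :=
    ∃ N, ∀ x, ∃ x', eval φ x' = g * eval φ x ∧ δ x x' ≤ N
  have hof (a) : P (of a) := by
    obtain ⟨N, hN⟩ := h.mul_left a
    exact ⟨N, fun x => ⟨(a * x.1, x.2), eval_mul _ _ _ _, hN _ _ _⟩⟩
  have hmul {g g'} (hg : P g) (hg' : P g') : P (g * g') := by
    obtain ⟨N, hN⟩ := hg
    obtain ⟨N', hN'⟩ := hg'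
    refine ⟨N' + N, fun x => ?_⟩
    obtain ⟨x', h₁, h₂⟩ := hN' x
    obtain ⟨x'', h₃, h₄⟩ := hN x'
    exact ⟨x'', by rw [h₃, h₁, mul_assoc], (hδ.tri _ _ _).trans (add_le_add h₂ h₄)⟩
  suffices P g ∧ P g⁻¹ from this.1
  induction g using induction_on with
  | of a => exact ⟨hof a, by simpa using hof a⁻¹⟩
  | t => exact ⟨by simpa [P] using exists_zpow_t_bound (φ := φ) hδ h 1,
      by simpa [P] using exists_zpow_t_bound (φ := φ) hδ h (-1)⟩
  | mul x y hx hy => exact ⟨hmul hx.1 hy.1, by simpa using hmul hy.2 hx.2⟩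
  | inv x hx => exact ⟨hx.2, by simpa using hx.1⟩

include hd in
theorem eval_bijective [Finite F] : Function.Bijective (eval (d := d) φ) := by
  refine ⟨eval_injective hd, fun g => ?_⟩
  obtain ⟨N, hN⟩ := exists_mul_bound (φ := φ) (d := d) (δ := fun _ _ => 0)
    ⟨fun _ => rfl, fun _ _ => rfl, fun _ _ _ => by simp⟩
    ⟨fun _ => ⟨0, by simp⟩, ⟨0, by simp⟩, ⟨0, by simp⟩⟩ g
  obtain ⟨x', hx', -⟩ := hN (1, 1, [])
  exact ⟨x', by rw [hx']; simp [eval, letters]⟩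

end HNNExtension

open scoped Pointwise

theorem exists_slotSystem {A C : Type*} [Group A] (pos : C → A) (q : A × ℤˣ → C)
    (hq : Function.Surjective q) {r r' : C} (hr : r' ≠ r) {T : Set A} (hT : T.Finite)
    (hs : ∀ e, e.1 * (pos (q e))⁻¹ ∈ T) :
    ∃ (s : SlotSystem C (A × ℤˣ)) (T' : Set A) (M : ℕ), T'.Finite ∧
      (∀ b e, e.1 * (pos (s.q b e))⁻¹ ∈ T') ∧ ∀ b c, (s.fib b c).length ≤ M := by
  classical
  let q' (b : Bool) (e : A × ℤˣ) : C := if b = true ∧ q e = r then r' else q e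
  let T' : Set A := T * {1, pos r * (pos r')⁻¹}
  have hT' : T'.Finite := hT.mul (by simp)
  have hs' (b e) : e.1 * (pos (q' b e))⁻¹ ∈ T' := by
    by_cases h : b = true ∧ q e = r
    · refine ⟨_, hs e, pos r * (pos r')⁻¹, by simp, ?_⟩
      simp [q', h]
    · refine ⟨_, hs e, 1, by simp, ?_⟩
      simp [q', h]
  have hmem (b c e) (h : q' b e = c) :
      (e.1 * (pos c)⁻¹, e.2) ∈ hT'.toFinset ×ˢ (Finset.univ : Finset ℤˣ) := by
    exact Finset.mem_product.2 ⟨by simpa [h] using hs' b e, Finset.mem_univ _⟩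
  have hinj (c : C) : Function.Injective fun e : A × ℤˣ => (e.1 * (pos c)⁻¹, e.2) := by
    rintro ⟨a, u⟩ ⟨a', u'⟩ h
    simpa using h
  have hfin (b c) : {e | q' b e = c}.Finite :=
    Set.Finite.of_finite_image (f := fun e : A × ℤˣ => (e.1 * (pos c)⁻¹, e.2))
      ((Finset.finite_toSet _).subset (Set.image_subset_iff.2 fun e he => hmem b c e he))
      (hinj c).injOn
  refine ⟨.ofFinite r q' hfin (fun b c hc => ?_) (fun e => ?_), T',
    (hT'.toFinset ×ˢ (Finset.univ : Finset ℤˣ)).card, hT', hs', fun b c => ?_⟩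
  · obtain ⟨e, rfl⟩ := hq c
    exact ⟨e, if_neg fun h => hc h.1 h.2⟩
  · by_cases h : q e = r <;> simp [q', h, hr]
  · simp only [SlotSystem.ofFinite, Finset.length_toList]
    refine Finset.card_le_card_of_injOn (fun e => (e.1 * (pos c)⁻¹, e.2)) (fun e he => ?_)
      (hinj c).injOn
    exact hmem b c e (by simpa using he)

/-- `Γ` is coarsely equivalent, by a bijection, to the tree of copies of `A` in which two children
are attached at every point of a copy. -/
def HasTreeModel (Γ A : Type*) [Group Γ] [Group A] : Prop :=
  ∃ Φ : Γ ≃ TreePoint A (A × ℤˣ),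
    (∀ δ, IsPseudoDist δ → TreeControlled Prod.fst δ → ∀ g, ∃ N, ∀ x, δ (Φ x) (Φ (g * x)) ≤ N) ∧
    ∀ d : Γ → Γ → ℕ, IsPseudoDist d → (∀ x y g, d (x * g) (y * g) = d x y) →
      TreeControlled Prod.fst fun y y' => d (Φ.symm y) (Φ.symm y')

theorem HasTreeModel.of_mulEquiv {Γ Γ' A : Type*} [Group Γ] [Group Γ'] [Group A]
    (h : HasTreeModel Γ A) (e : Γ' ≃* Γ) : HasTreeModel Γ' A := by
  obtain ⟨Φ, h₁, h₂⟩ := h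
  refine ⟨e.toEquiv.trans Φ, fun δ hδ hc g => ?_, fun d hd hr => ?_⟩
  · obtain ⟨N, hN⟩ := h₁ δ hδ hc (e g)
    exact ⟨N, fun x => by simpa using hN (e x)⟩
  · exact h₂ (fun x y => d (e.symm x) (e.symm y)) (hd.comap e.symm) fun x y g => by simp [hr]

theorem HasTreeModel.quasiIsometricGroups {Γ Γ' A : Type*} [Group Γ] [Group Γ'] [Group A]
    [hΓ : Group.FG Γ] [hΓ' : Group.FG Γ'] (h : HasTreeModel Γ A) (h' : HasTreeModel Γ' A) :
    QuasiIsometricGroups Γ Γ' := by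
  obtain ⟨S, hS⟩ := Group.fg_def.1 hΓ
  obtain ⟨S', hS'⟩ := Group.fg_def.1 hΓ'
  obtain ⟨Φ, h₁, h₂⟩ := h
  obtain ⟨Φ', h₁', h₂'⟩ := h'
  have hd := (isPseudoDist_wordDist hS).comap fun x => x⁻¹
  have hd' := (isPseudoDist_wordDist hS').comap fun x => x⁻¹
  refine quasiIsometricGroups_of_equiv hS hS' (Φ.trans Φ'.symm)
    (h₁ _ (hd'.comap Φ'.symm) (h₂' _ hd' fun x y g => ?_))
    (h₁' _ (hd.comap Φ.symm) (h₂ _ hd fun x y g => ?_))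
  all_goals simp only [mul_inv_rev, wordDist_mul_left]

namespace HNNExtension

open NormalWord

theorem hasTreeModel {A : Type*} [Group A] {F K : Subgroup A} (φ : F ≃* K) [Finite F]
    (hF : F ≠ ⊤) : HasTreeModel (HNNExtension A F K φ) A := by
  classical
  have : Finite K := .of_equiv F φ.toEquiv
  have hK : K ≠ ⊤ := by
    rintro rfl
    have : Finite A := .of_equiv _ Subgroup.topEquiv.toEquiv
    refine hF (Subgroup.eq_top_of_card_eq F ?_)
    rw [Nat.card_congr φ.toEquiv, Nat.card_congr Subgroup.topEquiv.toEquiv]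
  have hfin (u : ℤˣ) : (toSubgroup F K u : Set A).Finite := by
    rcases Int.units_eq_one_or u with rfl | rfl
    exacts [Set.toFinite (F : Set A), Set.toFinite (K : Set A)]
  have htop (u : ℤˣ) : toSubgroup F K u ≠ ⊤ := by
    rcases Int.units_eq_one_or u with rfl | rfl
    exacts [hF, hK]
  choose R hR using fun u => (toSubgroup F K u).exists_isComplement_right 1
  let d : TransversalPair A F K := ⟨R, fun u => (hR u).1⟩
  have hd (u) : (1 : A) ∈ d.set u := (hR u).2
  let rep (u : ℤˣ) (a : A) : A := ((d.compl u).equiv a).2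
  have hrep (u a) : rep u a ∈ d.set u := Subtype.prop _
  have hmul (u a) : a * (rep u a)⁻¹ ∈ toSubgroup F K u := by
    rw [← (d.compl u).equiv_fst_eq_mul_inv]
    exact Subtype.prop _
  have hex (u) : ∃ a, rep u a ≠ 1 := by
    obtain ⟨a, ha⟩ := SetLike.exists_not_mem_of_ne_top _ (htop u) rfl
    exact ⟨a, fun h => ha (by simpa [h] using hmul u a)⟩
  choose p hp using hex
  let r (u : ℤˣ) : NontrivialRep d := ⟨(u, rep u (p u)), hrep _ _, hp u⟩
  let q (e : A × ℤˣ) : NontrivialRep d :=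
    if h : rep e.2 e.1 = 1 then r e.2 else ⟨(e.2, rep e.2 e.1), hrep _ _, h⟩
  have hq : Function.Surjective q := by
    rintro ⟨⟨u, c⟩, hc, hne⟩
    have h : rep u c = c := congrArg Subtype.val
      ((d.compl u).equiv_snd_eq_self_of_mem_of_one_mem (one_mem _) hc)
    refine ⟨(c, u), ?_⟩
    simp only [q, h]
    exact dif_neg hne
  have hrr : r (-1) ≠ r 1 := fun h => by
    have := congrArg (fun c => c.1.1) h
    simp [r] at this
  obtain ⟨s, T, M, hT, hs, hM⟩ := exists_slotSystem (fun c : NontrivialRep d => c.1.2) q hq hrr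
    (T := ⋃ u, (toSubgroup F K u : Set A) * {1, (rep u (p u))⁻¹})
    (Set.finite_iUnion fun u => (hfin u).mul (by simp)) (by
      rintro ⟨a, u⟩
      refine Set.mem_iUnion.2 ⟨u, ?_⟩
      by_cases h : rep u a = 1
      · refine ⟨a, by simpa [h] using hmul u a, (rep u (p u))⁻¹, by simp, ?_⟩
        simp [q, h, r]
      · exact ⟨_, hmul u a, 1, by simp, by simp [q, h]⟩)
  let e := Equiv.ofBijective (eval (d := d) φ) (eval_bijective hd)
  refine ⟨e.symm.trans (s.treeEquiv A), fun δ hδ h g => ?_, fun δ hδ h => ?_⟩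
  · obtain ⟨N, hN⟩ := exists_mul_bound (φ := φ) (hδ.comap (s.treeEquiv A))
      (s.treeControlled_treeEquiv hδ h hT hs hM) g
    refine ⟨N, fun x => ?_⟩
    obtain ⟨x', hx', hx⟩ := hN (e.symm x)
    have : e.symm (g * x) = x' := by
      rw [Equiv.symm_apply_eq]
      change _ = eval φ x'
      rw [hx']
      exact congrArg _ (e.apply_symm_apply x).symm
    simpa [this] using hx
  · exact s.treeControlled_treeEquiv_symm (hδ.comap (eval φ)) (treeControlled_eval h) hT hs hM

instance fg {A : Type*} [Group A] {F K : Subgroup A} {φ : F ≃* K} [hA : Group.FG A] :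
    Group.FG (HNNExtension A F K φ) := by
  rw [Group.fg_iff] at hA ⊢
  obtain ⟨S, hS, hfin⟩ := hA
  refine ⟨insert t (of '' S), top_unique fun x _ => ?_, (hfin.image _).insert _⟩
  induction x using induction_on with
  | of a =>
    have : (Subgroup.closure S).map of ≤ Subgroup.closure (insert (t : HNNExtension A F K φ)
        (of '' S)) := by
      rw [MonoidHom.map_closure]
      exact Subgroup.closure_mono (Set.subset_insert _ _)
    exact this ⟨a, by simp [hS], rfl⟩
  | t => exact Subgroup.subset_closure (Set.mem_insert _ _)
  | mul x y hx hy => exact mul_mem (hx trivial) (hy trivial)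
  | inv x hx => exact inv_mem (hx trivial)

/-- The HNN extension relative to trivial subgroups is the free product with `ℤ`. -/
noncomputable def botEquivCoprod (A : Type*) [Group A] :
    HNNExtension A ⊥ ⊥ (MulEquiv.refl (⊥ : Subgroup A)) ≃*
      Monoid.Coprod A (Multiplicative ℤ) :=
  MonoidHom.toMulEquiv
    (lift Monoid.Coprod.inl (Monoid.Coprod.inr (Multiplicative.ofAdd 1)) (by
      rintro ⟨a, ha⟩
      obtain rfl := Subgroup.mem_bot.1 ha
      simp))
    (Monoid.Coprod.lift of (zpowersHom _ t))
    (by ext <;> simp)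
    (by ext <;> simp)

end HNNExtension

/-- **Theorem 2 (Amalgamation), second part.** Let `A` be a finitely generated
group and `F` a finite proper subgroup of `A` equipped with a second embedding
into `A` (recorded by the subgroup `K` and the isomorphism `φ : F ≃* K`),
defining the HNN extension `A *_F`.  Then `A *_F` is quasi-isometric to the
free product `A * ℤ`. -/
theorem hnnExtension_quasiIsometric_freeProduct_int
    (A : Type) [Group A] [Group.FG A] (F K : Subgroup A) [Finite F]
    (hF : F ≠ ⊤) (φ : F ≃* K) :
    QuasiIsometricGroups (HNNExtension A F K φ) (Monoid.Coprod A (Multiplicative ℤ)) := by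
  have hbot : (⊥ : Subgroup A) ≠ ⊤ := fun h => hF (top_unique (h ▸ bot_le))
  have e := HNNExtension.botEquivCoprod A
  have : Group.FG (Monoid.Coprod A (Multiplicative ℤ)) :=
    Group.fg_of_surjective (f := e.toMonoidHom) e.surjective
  exact (HNNExtension.hasTreeModel φ hF).quasiIsometricGroups
    ((HNNExtension.hasTreeModel (MulEquiv.refl (⊥ : Subgroup A)) hbot).of_mulEquiv e.symm)
end
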